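/- Let p be a prime, V = GF(p)^a ⊗ GF(p)^c with 2 ≤ c ≤ a, and let D be a nontrivial 2-(p^{ac},k,2) design with point set V and even replication number r, admitting a flag-transitive, point-primitive automorphism group G = T ⋊ G_0, where T is the translation group of V and G_0 is contained in the normalizer in GL(V) of the subgroup {g ⊗ h : g ∈ GL_a(p), h ∈ GL_c(p)}. Then one of the following holds: (1) p = 2, a = c = 2, k = r = 6; (2) p = 3, a = c = 2, k = 6, r = 32; (3) p = 2, a = 3, c = 2, k = 4, r = 42; (4) p = 3, a = 3, c = 2, k = 8, r = 208. -/

import Mathlib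

open TensorProduct


structure Dsg {F V : Type*} [Field F] [AddCommGroup V] [Module F V] (𝓑 : Set (Set V)) (k r : ℕ)
    (G₀ : Subgroup (V ≃ₗ[F] V)) : Prop where
  hk : ∀ B ∈ 𝓑, B.ncard = k
  hlam : ∀ x y : V, x ≠ y → {B ∈ 𝓑 | x ∈ B ∧ y ∈ B}.ncard = 2
  hr : ∀ x : V, {B ∈ 𝓑 | x ∈ B}.ncard = r
  hk2 : 2 < k
  hkv : k < Nat.card V
  hinv : ∀ B ∈ 𝓑, ∀ g ∈ G₀, ∀ v : V, (fun x => g x + v) '' B ∈ 𝓑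
  hflag : ∀ B ∈ 𝓑, ∀ C ∈ 𝓑, ∀ x ∈ B, ∀ y ∈ C,
      ∃ g ∈ G₀, ∃ v : V, (fun z => g z + v) '' B = C ∧ g x + v = y

/-- double counting of an incidence relation -/
theorem dcount {α β : Type*} [Finite α] [Finite β] (R : α → β → Prop) (s : Set α) (t : Set β)
    (m n : ℕ) (hm : ∀ x ∈ s, {y ∈ t | R x y}.ncard = m) (hn : ∀ y ∈ t, {x ∈ s | R x y}.ncard = n) :
    s.ncard * m = t.ncard * n := by
  classical
  have := Fintype.ofFinite α
  have := Fintype.ofFinite β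
  have h := Finset.sum_card_bipartiteAbove_eq_sum_card_bipartiteBelow
    (s := s.toFinset) (t := t.toFinset) R
  rw [Finset.sum_congr rfl (g := fun _ => m), Finset.sum_congr (s₁ := t.toFinset) rfl (g := fun _ => n)] at h
  · simpa [Set.ncard_eq_toFinset_card'] using h
  · intro y hy
    rw [← hn y (by simpa using hy), Set.ncard_eq_toFinset_card']
    congr 1; ext; simp [Finset.bipartiteBelow]
  · intro y hy
    rw [← hm y (by simpa using hy), Set.ncard_eq_toFinset_card']
    congr 1; ext; simp [Finset.bipartiteAbove]

namespace Dsg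
set_option linter.unusedSectionVars false
variable {F V : Type*} [Field F] [AddCommGroup V] [Module F V] {𝓑 : Set (Set V)} {k r : ℕ}
    {G₀ : Subgroup (V ≃ₗ[F] V)} [Finite V]

theorem trans_mem (D : Dsg 𝓑 k r G₀) {B : Set V} (hB : B ∈ 𝓑) (v : V) : (fun x => x + v) '' B ∈ 𝓑 := by
  simpa using D.hinv B hB 1 G₀.one_mem v

theorem map_mem (D : Dsg 𝓑 k r G₀) {B : Set V} (hB : B ∈ 𝓑) {g : V ≃ₗ[F] V} (hg : g ∈ G₀) : g '' B ∈ 𝓑 := by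
  simpa using D.hinv B hB g hg 0

theorem exists_block (D : Dsg 𝓑 k r G₀) (x : V) : ∃ B ∈ 𝓑, x ∈ B := by
  have : Nontrivial V := by
    rw [← Finite.one_lt_card_iff_nontrivial]; have := D.hk2; have := D.hkv; omega
  obtain ⟨y, hy⟩ := exists_ne x
  have h := D.hlam x y hy.symm
  have : {B ∈ 𝓑 | x ∈ B ∧ y ∈ B}.Nonempty := by
    rw [Set.nonempty_iff_ne_empty]; rintro h0; rw [h0] at h; simp at h
  obtain ⟨B, hB, hx, -⟩ := this
  exact ⟨B, hB, hx⟩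

theorem orbit_count (D : Dsg 𝓑 k r G₀) (Γ : Set V) (h0 : (0:V) ∉ Γ) (hΓ : ∀ g ∈ G₀, ∀ x ∈ Γ, g x ∈ Γ) :
    ∃ n, (∀ B ∈ 𝓑, ∀ x ∈ B, {y ∈ B | y - x ∈ Γ}.ncard = n) ∧ r * n = Γ.ncard * 2 := by
  obtain ⟨B₀, hB₀, hx₀⟩ := D.exists_block 0
  have key : ∀ B ∈ 𝓑, ∀ x ∈ B, {y ∈ B | y - x ∈ Γ}.ncard = {y ∈ B₀ | y - 0 ∈ Γ}.ncard := by
    intro B hB x hx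
    obtain ⟨g, hg, v, h1, h2⟩ := D.hflag B₀ hB₀ B hB 0 hx₀ x hx
    rw [← Set.ncard_image_of_injective (f := fun z => g z + v) {y ∈ B₀ | y - 0 ∈ Γ} (fun a b h => by simpa using h)]
    congr 1
    ext y
    simp only [Set.mem_ofPred_eq, Set.mem_image]
    constructor
    · rintro ⟨hy, hyΓ⟩
      rw [← h1] at hy
      obtain ⟨z, hz, rfl⟩ := hy
      refine ⟨z, ⟨hz, ?_⟩, rfl⟩
      have := hΓ g⁻¹ (G₀.inv_mem hg) _ hyΓ
      rw [← h2] at this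
      simpa [← map_sub] using this
    · rintro ⟨z, ⟨hz, hzΓ⟩, rfl⟩
      refine ⟨h1 ▸ ⟨z, hz, rfl⟩, ?_⟩
      rw [← h2]
      simpa using hΓ g hg _ hzΓ
  refine ⟨_, key, ?_⟩
  have := dcount (fun (B : Set V) (y : V) => y ∈ B) {B ∈ 𝓑 | (0:V) ∈ B} Γ
    {y ∈ B₀ | y - 0 ∈ Γ}.ncard 2 ?_ ?_
  · rw [D.hr] at this; exact this
  · rintro B ⟨hB, h0B⟩
    rw [← key B hB 0 h0B]; congr 1; ext; simp [and_comm]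
  · intro y hy
    rw [← D.hlam 0 y (fun h => h0 (h ▸ hy))]
    congr 1; ext; simp [and_assoc]

theorem rk (D : Dsg 𝓑 k r G₀) : r * (k - 1) = 2 * (Nat.card V - 1) := by
  obtain ⟨n, h1, h2⟩ := D.orbit_count {x | x ≠ 0} (by simp) (by intro g _ x hx; simpa using hx)
  obtain ⟨B₀, hB₀, hx₀⟩ := D.exists_block 0
  have e1 : n = k - 1 := by
    rw [← h1 B₀ hB₀ 0 hx₀, ← D.hk B₀ hB₀, ← Set.ncard_sdiff_singleton_of_mem hx₀]
    congr 1; ext; simp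
  have e2 : {x : V | x ≠ 0}.ncard = Nat.card V - 1 := by
    have : {x : V | x ≠ 0} = {0}ᶜ := by ext; simp
    rw [this, Set.ncard_compl]; simp
  rw [e1, e2] at h2; omega

theorem bk (D : Dsg 𝓑 k r G₀) : 𝓑.ncard * k = Nat.card V * r := by
  have := dcount (fun (B : Set V) (y : V) => y ∈ B) 𝓑 Set.univ k r ?_ ?_
  · rwa [Set.ncard_univ] at this
  · intro B hB; rw [← D.hk B hB]; congr 1; ext; simp
  · intro y _; rw [← D.hr y]

theorem fisher (D : Dsg 𝓑 k r G₀) : k ≤ r := by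
  classical
  have := Fintype.ofFinite V
  have hrk := D.rk
  have hk2 := D.hk2
  have hkv := D.hkv
  have hr2 : 2 < r := by
    by_contra h
    have : r * (k-1) ≤ 2 * (k-1) := Nat.mul_le_mul_right _ (by omega)
    omega
  have hinj : Function.Injective (fun (f : V → ℚ) (B : 𝓑) => ∑ x, if x ∈ (B : Set V) then f x else 0) := by
    let L : (V → ℚ) →ₗ[ℚ] (𝓑 → ℚ) :=
      { toFun := fun (f : V → ℚ) (B : 𝓑) => ∑ x, if x ∈ (B : Set V) then f x else 0
        map_add' := by
          intro f g; ext B; simp only [Pi.add_apply, ← Finset.sum_add_distrib]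
          apply Finset.sum_congr rfl; intro x _; split_ifs <;> simp
        map_smul' := by
          intro c f; ext B; simp only [Pi.smul_apply, smul_eq_mul, Finset.mul_sum, RingHom.id_apply]
          apply Finset.sum_congr rfl; intro x _; split_ifs <;> simp }
    change Function.Injective L
    rw [← LinearMap.ker_eq_bot, LinearMap.ker_eq_bot']
    intro f hf
    have h0 : ∀ B : 𝓑, ∑ x, (if x ∈ (B : Set V) then f x else 0) = 0 := fun B => congrFun hf B
    -- for each x: sum over blocks
    have h1 : ∀ x, (r - 2 : ℚ) * f x + 2 * ∑ y, f y = 0 := by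
      intro x
      have e : ∑ B : 𝓑, (if x ∈ (B : Set V) then ∑ y, (if y ∈ (B : Set V) then f y else 0) else 0) = 0 := by
        apply Finset.sum_eq_zero; intro B _; rw [h0]; simp
      have e2 : ∑ B : 𝓑, (if x ∈ (B : Set V) then ∑ y, (if y ∈ (B : Set V) then f y else 0) else 0)
          = ∑ y, (if x = y then (r:ℚ) else 2) * f y := by
        have : ∀ B : 𝓑, (if x ∈ (B : Set V) then ∑ y, (if y ∈ (B : Set V) then f y else 0) else 0)
            = ∑ y, if (x ∈ (B : Set V) ∧ y ∈ (B : Set V)) then f y else 0 := by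
          intro B; split_ifs with h <;> simp [h]
        rw [Finset.sum_congr rfl (fun B _ => this B), Finset.sum_comm]
        apply Finset.sum_congr rfl
        intro y _
        rw [← Finset.sum_filter, Finset.sum_const, nsmul_eq_mul]
        congr 1
        have : ∀ (P : Set V → Prop), (Finset.univ.filter (fun B : 𝓑 => P B)).card = {B ∈ 𝓑 | P B}.ncard := by
          intro P
          rw [← Set.ncard_coe_finset, ← Set.ncard_image_of_injective _ Subtype.val_injective]
          congr 1; ext B; simp [and_comm]
        trans (({B ∈ 𝓑 | x ∈ B ∧ y ∈ B}.ncard : ℕ) : ℚ)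
        · rw [← this (fun B => x ∈ B ∧ y ∈ B)]
          congr!
        split_ifs with h
        · subst h; simp [D.hr]
        · rw [D.hlam x y h]; norm_num
      rw [e2] at e
      have e3 : ∑ y, (if x = y then (r:ℚ) else 2) * f y = ∑ y, ((if x = y then (r - 2 : ℚ) * f y else 0) + 2 * f y) := by
        apply Finset.sum_congr rfl; intro y _; split_ifs <;> ring
      rw [e3, Finset.sum_add_distrib, Finset.sum_ite_eq, ← Finset.mul_sum] at e
      simpa using e
    have hr2' : (2:ℚ) < r := by exact_mod_cast hr2
    have h2 : ∑ y, f y = 0 := by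
      have : ∑ x, ((r - 2 : ℚ) * f x + 2 * ∑ y, f y) = 0 := Finset.sum_eq_zero (fun x _ => h1 x)
      rw [Finset.sum_add_distrib, ← Finset.mul_sum, Finset.sum_const, nsmul_eq_mul] at this
      have h3 : ((r - 2 : ℚ) + Fintype.card V * 2) * ∑ y, f y = 0 := by
        simp only [Finset.card_univ] at this; linarith
      rcases mul_eq_zero.1 h3 with h | h
      · have : (0:ℚ) ≤ Fintype.card V := by positivity
        linarith
      · exact h
    ext x
    have := h1 x
    rw [h2, mul_zero, add_zero] at this
    rcases mul_eq_zero.1 this with h | h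
    · linarith
    · exact h
  have hle : Nat.card V ≤ 𝓑.ncard := by
    let L : (V → ℚ) →ₗ[ℚ] (𝓑 → ℚ) :=
      { toFun := fun (f : V → ℚ) (B : 𝓑) => ∑ x, if x ∈ (B : Set V) then f x else 0
        map_add' := by
          intro f g; ext B; simp only [Pi.add_apply, ← Finset.sum_add_distrib]
          apply Finset.sum_congr rfl; intro x _; split_ifs <;> simp
        map_smul' := by
          intro c f; ext B; simp only [Pi.smul_apply, smul_eq_mul, Finset.mul_sum, RingHom.id_apply]
          apply Finset.sum_congr rfl; intro x _; split_ifs <;> simp }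
    have := LinearMap.finrank_le_finrank_of_injective (f := L) hinj
    simpa [Set.ncard_eq_toFinset_card', Nat.card_eq_fintype_card] using this
  have hbk := D.bk
  have : Nat.card V * k ≤ Nat.card V * r := by
    rw [← hbk]; exact Nat.mul_le_mul_right _ hle
  exact Nat.le_of_mul_le_mul_left this (by omega)

theorem dvd_or (D : Dsg 𝓑 k r G₀) : k ∣ r ∨ k ∣ 2 * Nat.card V := by
  by_cases h : ∃ B ∈ 𝓑, ∃ w : V, w ≠ 0 ∧ (fun x => x + w) '' B = B
  · right
    obtain ⟨B, hB, w, hw, hBw⟩ := h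
    have tr : ∀ (C : Set V) (v : V), (fun x => x + w) '' C = C →
        (fun x => x + w) '' ((fun x => x + v) '' C) = (fun x => x + v) '' C := by
      intro C v hC
      conv_rhs => rw [← hC]
      rw [Set.image_image, Set.image_image]
      congr 1; ext x; abel
    have hs : ∀ x, {C ∈ {C ∈ 𝓑 | (fun x => x + w) '' C = C} | x ∈ C}.ncard =
        {C ∈ {C ∈ 𝓑 | (fun x => x + w) '' C = C} | (0:V) ∈ C}.ncard := by
      intro x
      rw [← Set.ncard_image_of_injective (f := fun C : Set V => (fun y => y + x) '' C)
        {C ∈ {C ∈ 𝓑 | (fun x => x + w) '' C = C} | (0:V) ∈ C}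
        (Set.image_injective.2 (add_left_injective x))]
      congr 1
      ext C
      simp only [Set.mem_ofPred_eq, Set.mem_image]
      constructor
      · rintro ⟨⟨h1, h2⟩, h3⟩
        refine ⟨(fun y => y + (-x)) '' C, ⟨⟨D.trans_mem h1 _, tr _ _ h2⟩, ⟨x, h3, by simp⟩⟩, ?_⟩
        rw [Set.image_image]; simp
      · rintro ⟨C, ⟨⟨h1, h2⟩, h3⟩, rfl⟩
        exact ⟨⟨D.trans_mem h1 _, tr _ _ h2⟩, ⟨0, h3, by simp⟩⟩
    have hc := dcount (fun (B : Set V) (y : V) => y ∈ B) {C ∈ 𝓑 | (fun x => x + w) '' C = C} Set.univ k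
      {C ∈ {C ∈ 𝓑 | (fun x => x + w) '' C = C} | (0:V) ∈ C}.ncard ?_ ?_
    · set s := {C ∈ {C ∈ 𝓑 | (fun x => x + w) '' C = C} | (0:V) ∈ C}.ncard with hsd
      have hs2 : s ≤ 2 := by
        rw [← D.hlam 0 w hw.symm]
        apply Set.ncard_le_ncard _ (Set.toFinite _)
        rintro C ⟨⟨h1, h2⟩, h3⟩
        exact ⟨h1, h3, h2 ▸ ⟨0, h3, by simp⟩⟩
      have hs1 : 0 < s := by
        have hne : B.Nonempty := by
          rw [← Set.ncard_pos (Set.toFinite _), D.hk B hB]; have := D.hk2; omega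
        obtain ⟨x, hx⟩ := hne
        rw [← hs x, Set.ncard_pos (Set.toFinite _)]
        exact ⟨B, ⟨hB, hBw⟩, hx⟩
      rw [Set.ncard_univ] at hc
      have : k ∣ Nat.card V * s := ⟨_, by rw [← hc, mul_comm]⟩
      refine this.trans ?_
      rw [mul_comm]
      apply Nat.mul_dvd_mul_right
      interval_cases s <;> norm_num
    · rintro C ⟨hC, -⟩; rw [← D.hk C hC]; congr 1; ext; simp
    · intro y _; exact hs y
  · left
    push Not at h
    let act : AddAction V 𝓑 :=
      { vadd := fun v B => ⟨(fun x => x + v) '' (B : Set V), D.trans_mem B.2 v⟩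
        zero_vadd := by intro B; apply Subtype.ext; change (fun x => x + (0:V)) '' (B : Set V) = B; simp
        add_vadd := by
          intro v w B; apply Subtype.ext
          change (fun x => x + (v + w)) '' (B : Set V) = (fun x => x + v) '' ((fun x => x + w) '' (B : Set V))
          rw [Set.image_image]; congr 1; ext x; abel }
    have e := AddAction.selfEquivOrbitsQuotientProd (G := V) (X := 𝓑) (by
      intro B
      rw [eq_bot_iff]
      intro v hv
      by_contra hv0
      refine h B B.2 v (by simpa using hv0) ?_
      exact congrArg Subtype.val (AddAction.mem_stabilizer_iff.1 hv))
    have hcard := Nat.card_congr e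
    rw [Nat.card_prod, Nat.card_coe_set_eq] at hcard
    have hbk := D.bk
    rw [hcard] at hbk
    have hv : 0 < Nat.card V := by have := D.hkv; omega
    exact ⟨_, Nat.eq_of_mul_eq_mul_left hv (by rw [← hbk]; ring)⟩
end Dsg


namespace Tn
set_option linter.unusedSectionVars false
variable {F E U : Type*} [Field F] [AddCommGroup E] [Module F E] [AddCommGroup U] [Module F U]

/-- contraction of the left factor -/
noncomputable def cl (φ : Module.Dual F E) : E ⊗[F] U →ₗ[F] U :=
  (TensorProduct.lid F U).toLinearMap ∘ₗ LinearMap.rTensor U φ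

/-- contraction of the right factor -/
noncomputable def cr (φ : Module.Dual F U) : E ⊗[F] U →ₗ[F] E :=
  (TensorProduct.rid F E).toLinearMap ∘ₗ LinearMap.lTensor E φ

@[simp] theorem cl_tmul (φ : Module.Dual F E) (f : E) (u : U) : cl φ (f ⊗ₜ[F] u) = φ f • u := by
  simp [cl]

@[simp] theorem cr_tmul (φ : Module.Dual F U) (f : E) (u : U) : cr φ (f ⊗ₜ[F] u) = φ u • f := by
  simp [cr]

theorem eq_zero_of_cl (x : E ⊗[F] U) (h : ∀ φ : Module.Dual F E, cl φ x = 0) : x = 0 := by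
  classical
  let b := Module.Free.chooseBasis F E
  apply (TensorProduct.equivFinsuppOfBasisLeft (N := U) b).injective
  ext i
  rw [TensorProduct.equivFinsuppOfBasisLeft_apply]
  simpa [cl] using h (b.coord i)

theorem tmul_ne_zero {f : E} {u : U} (hf : f ≠ 0) (hu : u ≠ 0) : f ⊗ₜ[F] u ≠ 0 := by
  intro h
  obtain ⟨φ, hφ⟩ := Module.Projective.exists_dual_eq_one F hf
  have := congrArg (cl φ) h
  simp [hφ] at this
  exact hu this

theorem tmul_eq {f f' : E} {u u' : U} (hf : f ≠ 0) (hu : u ≠ 0)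
    (h : f ⊗ₜ[F] u = f' ⊗ₜ[F] u') : ∃ c : F, c ≠ 0 ∧ f' = c • f ∧ u' = c⁻¹ • u := by
  have h0 : f' ⊗ₜ[F] u' ≠ 0 := h ▸ tmul_ne_zero hf hu
  have hu' : u' ≠ 0 := by rintro rfl; simp at h0
  have hf' : f' ≠ 0 := by rintro rfl; simp at h0
  obtain ⟨φ, hφ⟩ := Module.Projective.exists_dual_eq_one F hu'
  have e1 := congrArg (cr φ) h
  simp only [cr_tmul, hφ, one_smul] at e1
  have hc : φ u ≠ 0 := by intro h; rw [h, zero_smul] at e1; exact hf' e1.symm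
  refine ⟨φ u, hc, e1.symm, ?_⟩
  obtain ⟨χ, hχ⟩ := Module.Projective.exists_dual_eq_one F hf
  have e2 := congrArg (cl χ) h
  simp only [cl_tmul, hχ, one_smul] at e2
  rw [← e1, map_smul, hχ] at e2
  rw [smul_eq_mul, mul_one] at e2
  calc u' = (φ u)⁻¹ • (φ u • u') := by rw [smul_smul, inv_mul_cancel₀ hc, one_smul]
    _ = (φ u)⁻¹ • u := by rw [← e2]

variable (F E U) in
/-- rank one tensors -/
def R1 : Set (E ⊗[F] U) := {x | ∃ f : E, f ≠ 0 ∧ ∃ u : U, u ≠ 0 ∧ f ⊗ₜ[F] u = x}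

theorem zero_notMem_R1 : (0 : E ⊗[F] U) ∉ R1 F E U := by
  rintro ⟨f, hf, u, hu, h⟩; exact tmul_ne_zero hf hu h

theorem tmul_mem_R1 {f : E} {u : U} (hf : f ≠ 0) (hu : u ≠ 0) : f ⊗ₜ[F] u ∈ R1 F E U :=
  ⟨f, hf, u, hu, rfl⟩

theorem card_R1 [Finite E] [Finite U] [Finite F] :
    (Nat.card F - 1) * (R1 F E U).ncard = (Nat.card E - 1) * (Nat.card U - 1) := by
  classical
  have : Finite (E ⊗[F] U) := Module.finite_of_finite F
  have hE : {x : E | x ≠ 0}.ncard = Nat.card E - 1 := by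
    have : {x : E | x ≠ 0} = {0}ᶜ := by ext; simp
    rw [this, Set.ncard_compl]; simp
  have hU : {x : U | x ≠ 0}.ncard = Nat.card U - 1 := by
    have : {x : U | x ≠ 0} = {0}ᶜ := by ext; simp
    rw [this, Set.ncard_compl]; simp
  have hF : {x : F | x ≠ 0}.ncard = Nat.card F - 1 := by
    have : {x : F | x ≠ 0} = {0}ᶜ := by ext; simp
    rw [this, Set.ncard_compl]; simp
  have := dcount (fun (q : E × U) (x : E ⊗[F] U) => q.1 ⊗ₜ[F] q.2 = x) ({x : E | x ≠ 0} ×ˢ {x : U | x ≠ 0})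
    (R1 F E U) 1 (Nat.card F - 1) ?_ ?_
  · rw [Set.ncard_prod, hE, hU] at this
    rw [mul_comm, ← this, mul_one]
  · rintro ⟨f, u⟩ ⟨hf, hu⟩
    rw [Set.ncard_eq_one]
    refine ⟨f ⊗ₜ u, ?_⟩
    ext y
    simp only [Set.mem_ofPred_eq, Set.mem_singleton_iff]
    constructor
    · rintro ⟨_, h⟩; exact h.symm
    · rintro rfl; exact ⟨tmul_mem_R1 hf hu, rfl⟩
  · rintro x ⟨f, hf, u, hu, rfl⟩
    rw [← hF]
    symm
    apply Set.ncard_congr (fun c _ => (c • f, c⁻¹ • u))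
    · intro c hc
      simp only [Set.mem_ofPred_eq] at hc
      simp [hc, hf, hu, TensorProduct.smul_tmul', smul_smul]
    · intro c d _ _ h
      simp only [Prod.mk.injEq] at h
      exact smul_left_injective F hf h.1
    · rintro ⟨f', u'⟩ ⟨_, h⟩
      obtain ⟨c, hc, h1, h2⟩ := tmul_eq hf hu h.symm
      exact ⟨c, hc, Prod.ext h1.symm h2.symm⟩

theorem gl_trans {x y : E} (hx : x ≠ 0) (hy : y ≠ 0) : ∃ g : E ≃ₗ[F] E, g x = y := by
  let e := (LinearEquiv.toSpanNonzeroSingleton F E x hx).symm ≪≫ₗ LinearEquiv.toSpanNonzeroSingleton F E y hy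
  obtain ⟨g, hg⟩ := Submodule.exists_linearEquiv_restrict_eq e
  refine ⟨g, ?_⟩
  have h := hg ⟨x, Submodule.mem_span_singleton_self x⟩
  rw [← h]
  have : (LinearEquiv.toSpanNonzeroSingleton F E x hx).symm ⟨x, Submodule.mem_span_singleton_self x⟩ = 1 := by
    rw [LinearEquiv.symm_apply_eq]; ext; simp
  simp [e, this]

theorem fixed_lem {p : ℕ} [Fact p.Prime] {E U : Type*} [AddCommGroup E] [Module (ZMod p) E]
    [AddCommGroup U] [Module (ZMod p) U] [Finite E] [Finite U] (O : Set (E ⊗[ZMod p] U))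
    (hO : ∀ (g : E ≃ₗ[ZMod p] E) (h : U ≃ₗ[ZMod p] U), ∀ x ∈ O, TensorProduct.congr g h x ∈ O)
    (hp : ¬ p ∣ O.ncard) (e : E) (he : e ≠ 0) : ∃ x ∈ O, ∃ w : U, x = e ⊗ₜ w := by
  let K : Submodule (ZMod p) (Module.Dual (ZMod p) E) := LinearMap.ker (Module.Dual.eval (ZMod p) E e)
  have hK : ∀ φ : K, (φ : Module.Dual (ZMod p) E) e = 0 := fun φ => by
    exact LinearMap.mem_ker.1 φ.2
  have hcl : ∀ (φ χ : Module.Dual (ZMod p) E) (x : E ⊗[ZMod p] U), cl (φ + χ) x = cl φ x + cl χ x := by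
    intro φ χ x
    simp [cl, LinearMap.rTensor_add]
  have hcl0 : ∀ (x : E ⊗[ZMod p] U), cl (0 : Module.Dual (ZMod p) E) x = 0 := by
    intro x
    simp [cl]
  have hmem : ∀ (φ : K), ∀ x ∈ O, x + e ⊗ₜ cl (φ : Module.Dual (ZMod p) E) x ∈ O := by
    intro φ x hx
    have := hO (LinearEquiv.transvection (hK φ)) (LinearEquiv.refl _ _) x hx
    convert this using 1
    clear hx this
    induction x with
    | zero => simp
    | tmul f u => simp [LinearMap.transvection.apply, TensorProduct.add_tmul, TensorProduct.smul_tmul]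
    | add x y hx hy => rw [map_add, map_add, TensorProduct.tmul_add, ← hx, ← hy]; abel
  let act : MulAction (Multiplicative K) O :=
    { smul := fun φ x => ⟨(x : E ⊗[ZMod p] U) + e ⊗ₜ cl (φ.toAdd : Module.Dual (ZMod p) E) x, hmem φ.toAdd x x.2⟩
      one_smul := by
        intro x; apply Subtype.ext
        change (x : E ⊗[ZMod p] U) + e ⊗ₜ[ZMod p] cl ((0 : K) : Module.Dual (ZMod p) E) (x : E ⊗[ZMod p] U) = (x : E ⊗[ZMod p] U)
        simp [hcl0]
      mul_smul := by
        intro φ χ x; apply Subtype.ext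
        change (x : E ⊗[ZMod p] U) + e ⊗ₜ cl ((φ.toAdd + χ.toAdd : K) : Module.Dual (ZMod p) E) x =
          ((x : E ⊗[ZMod p] U) + e ⊗ₜ cl (χ.toAdd : Module.Dual (ZMod p) E) x) +
          e ⊗ₜ cl (φ.toAdd : Module.Dual (ZMod p) E) ((x : E ⊗[ZMod p] U) + e ⊗ₜ cl (χ.toAdd : Module.Dual (ZMod p) E) x)
        rw [Submodule.coe_add, hcl, map_add, cl_tmul, hK, zero_smul, add_zero, TensorProduct.tmul_add]
        abel }
  have hpg : IsPGroup p (Multiplicative K) := by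
    intro φ
    refine ⟨1, ?_⟩
    apply Multiplicative.toAdd.injective
    rw [toAdd_pow, toAdd_one, pow_one]
    have : ((p : ZMod p)) • φ.toAdd = 0 := by simp
    rwa [Nat.cast_smul_eq_nsmul] at this
  obtain ⟨x, hx⟩ := hpg.nonempty_fixed_point_of_prime_not_dvd_card O (by rwa [Nat.card_coe_set_eq])
  have hfix : ∀ φ : Module.Dual (ZMod p) E, φ e = 0 → cl φ (x : E ⊗[ZMod p] U) = 0 := by
    intro φ hφ
    have h1 := hx (Multiplicative.ofAdd ⟨φ, by simpa [K] using hφ⟩)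
    have h2 : (x : E ⊗[ZMod p] U) + e ⊗ₜ[ZMod p] cl φ (x : E ⊗[ZMod p] U) = (x : E ⊗[ZMod p] U) := congrArg Subtype.val h1
    by_contra h3
    exact tmul_ne_zero he h3 (by simpa using h2)
  obtain ⟨χ, hχ⟩ := Module.Projective.exists_dual_eq_one (ZMod p) he
  refine ⟨x, x.2, cl χ (x : E ⊗[ZMod p] U), ?_⟩
  rw [← sub_eq_zero]
  apply eq_zero_of_cl
  intro θ
  have h1 := hfix (θ - θ e • χ) (by simp [hχ])
  have h2 : cl (θ - θ e • χ) (x : E ⊗[ZMod p] U) = cl θ (x : E ⊗[ZMod p] U) - θ e • cl χ (x : E ⊗[ZMod p] U) := by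
    simp [cl, LinearMap.rTensor_sub, LinearMap.rTensor_smul]
  rw [map_sub, cl_tmul, ← h2, h1]

theorem not_dvd_card {p : ℕ} [Fact p.Prime] (M : Type*) [AddCommGroup M] [Module (ZMod p) M] [Finite M]
    [Nontrivial M] : ¬ p ∣ Nat.card M - 1 := by
  have hp : p.Prime := Fact.out
  intro h
  have h1 := Module.natCard_eq_pow_finrank (K := ZMod p) (V := M)
  rw [Nat.card_zmod] at h1
  have h2 : 0 < Module.finrank (ZMod p) M := Module.finrank_pos
  have h3 : p ∣ Nat.card M := h1 ▸ dvd_pow_self p h2.ne'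
  have h4 : 0 < Nat.card M := Nat.card_pos
  have h5 : p ∣ 1 := by
    have := Nat.dvd_sub h3 h
    rwa [Nat.sub_sub_self h4] at this
  exact hp.one_lt.ne' (Nat.dvd_one.1 h5)

theorem not_dvd_R1 {p : ℕ} [Fact p.Prime] {E U : Type*} [AddCommGroup E] [Module (ZMod p) E]
    [AddCommGroup U] [Module (ZMod p) U] [Finite E] [Finite U] [Nontrivial E] [Nontrivial U] :
    ¬ p ∣ (R1 (ZMod p) E U).ncard := by
  have hp : p.Prime := Fact.out
  intro h
  have hc := card_R1 (F := ZMod p) (E := E) (U := U)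
  have h2 : p ∣ (Nat.card E - 1) * (Nat.card U - 1) := hc ▸ h.mul_left _
  rcases hp.dvd_mul.1 h2 with h3 | h3
  · exact not_dvd_card E h3
  · exact not_dvd_card U h3

theorem R1_inv {p : ℕ} [Fact p.Prime] {E U : Type*} [AddCommGroup E] [Module (ZMod p) E]
    [AddCommGroup U] [Module (ZMod p) U] [Finite E] [Finite U] [Nontrivial E] [Nontrivial U]
    (G₀ : Subgroup ((E ⊗[ZMod p] U) ≃ₗ[ZMod p] (E ⊗[ZMod p] U)))
    (hnorm : ∀ u ∈ G₀, ∀ (g : E ≃ₗ[ZMod p] E) (h : U ≃ₗ[ZMod p] U),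
      ∃ (g' : E ≃ₗ[ZMod p] E) (h' : U ≃ₗ[ZMod p] U),
        u * (TensorProduct.congr g h) * u⁻¹ = TensorProduct.congr g' h')
    (u : (E ⊗[ZMod p] U) ≃ₗ[ZMod p] (E ⊗[ZMod p] U)) (hu : u ∈ G₀) (x : E ⊗[ZMod p] U)
    (hx : x ∈ R1 (ZMod p) E U) : u x ∈ R1 (ZMod p) E U := by
  obtain ⟨e, he⟩ := exists_ne (0 : E)
  obtain ⟨y, hy, w, hw⟩ := fixed_lem (u '' R1 (ZMod p) E U) (by
    rintro g h _ ⟨z, hz, rfl⟩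
    obtain ⟨g', h', hgh⟩ := hnorm u⁻¹ (G₀.inv_mem hu) g h
    refine ⟨TensorProduct.congr g' h' z, ?_, ?_⟩
    · obtain ⟨f, hf, v, hv, rfl⟩ := hz
      exact ⟨g' f, by simpa using hf, h' v, by simpa using hv, by simp⟩
    · rw [← hgh]
      simp) (by
    rw [Set.ncard_image_of_injective _ u.injective]; exact not_dvd_R1) e he
  obtain ⟨z, hz, rfl⟩ := hy
  have hw0 : w ≠ 0 := by
    rintro rfl
    simp at hw
    exact zero_notMem_R1 (hw ▸ hz)
  obtain ⟨f, hf, v, hv, rfl⟩ := hz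
  obtain ⟨f', hf', v', hv', rfl⟩ := hx
  obtain ⟨g, rfl⟩ := gl_trans (F := ZMod p) hf hf'
  obtain ⟨h, rfl⟩ := gl_trans (F := ZMod p) hv hv'
  obtain ⟨g', h', hgh⟩ := hnorm u hu g h
  have : u ((g f) ⊗ₜ (h v)) = TensorProduct.congr g' h' (u (f ⊗ₜ v)) := by
    rw [← hgh]; simp
  rw [this, hw]
  exact ⟨g' e, by simpa using he, h' w, by simpa using hw0, by simp⟩
end Tn


namespace Ar

theorem dvdE {a b c : ℤ} (h : a ∣ b) (e : c = b) : a ∣ c := e ▸ h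

theorem c33 (p N r n : ℕ) (hp : 2 ≤ p) (hN : ((p:ℤ) - 1) * N = (p^3-1) * (p^3-1)) (hrn : r * n = N * 2)
    (K : ℤ) (hrk : (r:ℤ) * K = 2 * (p^9 - 1)) (hr2 : 2 * (p:ℤ)^9 ≤ r^2) : False := by
  have hp1 : ((p:ℤ) - 1) ≠ 0 := by have : (2:ℤ) ≤ p := by exact_mod_cast hp
                                   linarith
  have hN' : (N:ℤ) = (p^3-1) * (p^2+p+1) := mul_left_cancel₀ hp1 (by rw [hN]; ring)
  have hrn' : (r:ℤ) * n = N * 2 := by exact_mod_cast hrn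
  have hd : (r:ℤ) ∣ 6 * (p^3-1) := by
    have h1 : (r:ℤ) ∣ 2 * (p^9-1) := ⟨_, hrk.symm⟩
    have h2 : (r:ℤ) ∣ ((p:ℤ)-1)*(p^3+2) * (N * 2) := Dvd.dvd.mul_left ⟨_, hrn'.symm⟩ _
    have := dvd_sub h1 h2
    refine dvdE this ?_
    rw [hN']; ring
  have hp2 : (2:ℤ) ≤ p := by exact_mod_cast hp
  have hp3 : (8:ℤ) ≤ (p:ℤ)^3 := by
    calc (8:ℤ) = 2^3 := by norm_num
      _ ≤ (p:ℤ)^3 := by gcongr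
  have hle := Int.le_of_dvd (by linarith) hd
  have hr0 : (0:ℤ) ≤ r := by positivity
  rcases Nat.lt_or_ge p 3 with h | h
  · have : p = 2 := by omega
    subst this
    norm_num at hN' hr2 hrk hd
    have h1 : (r:ℤ) ∣ 98 := ⟨n, by rw [hrn', hN']; norm_num⟩
    have h2 : (r:ℤ) ∣ 14 := by
      have := dvd_sub (h1) (hd.mul_left 2)
      simpa using this
    have := Int.le_of_dvd (by norm_num) h2
    nlinarith
  · have hp3' : (27:ℤ) ≤ (p:ℤ)^3 := by
      have : (3:ℤ) ≤ p := by exact_mod_cast h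
      calc (27:ℤ) = 3^3 := by norm_num
        _ ≤ (p:ℤ)^3 := by gcongr
    have e : (p:ℤ)^9 = ((p:ℤ)^3)^3 := by ring
    rw [e] at hr2
    set x := (p:ℤ)^3
    have : (r:ℤ)^2 ≤ (6 * (x - 1))^2 := by gcongr
    nlinarith [sq_nonneg x, mul_nonneg (sq_nonneg x) (sub_nonneg.2 hp3')]

/-- concrete parameters -/
theorem conc {N r n v M : ℕ} (hrn : r * n = N * 2) (hr2 : 2 * v ≤ r^2) (hM : 2 * N * N < M * M * v) : n < M := by
  by_contra h
  push Not at h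
  have h1 : (r*n)^2 = (N*2)^2 := by rw [hrn]
  have h2 : 2 * v * (M * M) ≤ r^2 * (n*n) := by gcongr
  nlinarith

theorem c43 (p N r n k : ℕ) (hp : p.Prime) (hp5 : 5 ≤ p) (hN : ((p:ℤ) - 1) * N = (p^4-1) * (p^3-1))
    (hrn : r * n = N * 2) (hrk : (r:ℤ) * (k - 1) = 2 * (p^12 - 1)) (hkr : k ≤ r) (hk2 : 2 < k)
    (hd : k ∣ r ∨ k ∣ 2 * p^12) : False := by
  have hp5' : (5:ℤ) ≤ p := by exact_mod_cast hp5
  have hp1 : ((p:ℤ) - 1) ≠ 0 := by linarith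
  have hN' : (N:ℤ) = (p^4-1) * (p^2+p+1) := mul_left_cancel₀ hp1 (by rw [hN]; ring)
  have hrn' : (r:ℤ) * n = N * 2 := by exact_mod_cast hrn
  have hkr' : (k:ℤ) ≤ r := by exact_mod_cast hkr
  have hk2' : (2:ℤ) < k := by exact_mod_cast hk2
  have hr0 : (r:ℤ) ≠ 0 := by linarith
  obtain ⟨y, hy⟩ : ∃ y : ℤ, (p:ℤ) = 5 + y := ⟨p - 5, by ring⟩
  have hy0 : 0 ≤ y := by linarith
  have hNpos : (0:ℤ) < N := by
    rw [hN', hy]; ring_nf; positivity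
  have hn0 : (0:ℤ) < n := by
    rcases Nat.eq_zero_or_pos n with h | h
    · subst h; simp at hrn'; linarith
    · exact_mod_cast h
  have hk : (k:ℤ) - 1 = n * (p^6-p^5+p^3-p+1) := by
    have h1 : ((p:ℤ)^4-1) * (p^2+p+1) * (k-1) = (p^4-1) * (p^2+p+1) * (n * (p^6-p^5+p^3-p+1)) := by
      rw [← hN']
      have h2 : (r:ℤ) * (2 * (N * (k-1))) = r * (2 * (n * (p^12-1))) := by
        linear_combination (2 * N : ℤ) * hrk - (2*(p^12-1)) * hrn'
      have h3 := mul_left_cancel₀ hr0 h2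
      have h4 : (n:ℤ) * (p^12-1) = N * (n * (p^6-p^5+p^3-p+1)) := by rw [hN']; ring
      linarith
    refine mul_left_cancel₀ ?_ h1
    rw [← hN']; exact hNpos.ne'
  have hn1 : n = 1 := by
    by_contra hne
    have hn2 : (2:ℤ) ≤ n := by
      have : 0 < n := by exact_mod_cast hn0
      have : 2 ≤ n := by omega
      exact_mod_cast this
    have hK : (0:ℤ) < p^6-p^5+p^3-p+1 := by rw [hy]; ring_nf; positivity
    have h1 : (n:ℤ) * (n * (p^6-p^5+p^3-p+1)) < N * 2 := by
      rw [← hk, ← hrn', mul_comm (r:ℤ)]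
      apply mul_lt_mul_of_pos_left _ hn0; linarith
    have h2 : (2:ℤ) * (2 * (p^6-p^5+p^3-p+1)) ≤ n * (n * (p^6-p^5+p^3-p+1)) := by gcongr
    have h3 : (N:ℤ) * 2 < 2 * (2 * (p^6-p^5+p^3-p+1)) := by
      rw [hN', hy, ← sub_pos]; ring_nf; positivity
    linarith
  subst hn1
  have hk' : (k:ℤ) = p^6-p^5+p^3-p+2 := by push_cast at hk; linarith
  rcases hd with hd | hd
  · obtain ⟨t, ht⟩ := hd
    have ht' : (r:ℤ) = k * t := by exact_mod_cast ht
    have hr : (r:ℤ) = 2 * ((p^4-1) * (p^2+p+1)) := by push_cast at hrn'; rw [← hN']; linarith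
    rcases Nat.lt_or_ge p 7 with h7 | h7
    · have : p = 5 ∨ p = 6 := by omega
      rcases this with rfl | rfl
      · norm_num at hk' hr
        rw [hk', hr] at ht'
        omega
      · revert hp; norm_num
    · obtain ⟨z, hz⟩ : ∃ z : ℤ, (p:ℤ) = 7 + z := ⟨p - 7, by ring⟩
      have hz0 : 0 ≤ z := by have : (7:ℤ) ≤ p := by exact_mod_cast h7
                             linarith
      have h1 : (k:ℤ) * 2 < k * t := by
        rw [← ht', hr, hk', hz, ← sub_pos]; ring_nf; positivity
      have h2 : (k:ℤ) * t < k * 3 := by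
        rw [← ht', hr, hk', hz, ← sub_pos]; ring_nf; positivity
      have h3 := lt_of_mul_lt_mul_left h1 (by linarith)
      have h4 := lt_of_mul_lt_mul_left h2 (by linarith)
      omega
  · have hcop : Nat.Coprime k (p^12) := by
      apply Nat.Coprime.pow_right
      rw [Nat.coprime_comm, hp.coprime_iff_not_dvd]
      intro h
      have h1 : (p:ℤ) ∣ k := by exact_mod_cast h
      have h2 : (p:ℤ) ∣ 2 := by
        have : (p:ℤ) ∣ p * (p^5-p^4+p^2-1) := Dvd.intro _ rfl
        have := dvd_sub h1 this
        refine dvdE this ?_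
        rw [hk']; ring
      have := Int.le_of_dvd (by norm_num) h2
      linarith
    have := Nat.le_of_dvd (by norm_num) (hcop.dvd_of_dvd_mul_right hd)
    omega

theorem even2 (p a N r n k : ℕ) (hp : p.Prime) (ha : Even a) (ha2 : 2 ≤ a)
    (hN : ((p:ℤ) - 1) * N = (p^a-1) * (p^2-1))
    (hrn : r * n = N * 2) (hrk : (r:ℤ) * (k - 1) = 2 * (p^(a*2) - 1)) (hkr : k ≤ r) (hk2 : 2 < k)
    (hd : k ∣ r ∨ k ∣ 2 * p^(a*2)) :
    (p = 2 ∧ a = 2 ∧ k = 6 ∧ r = 6) ∨ (p = 3 ∧ a = 2 ∧ k = 6 ∧ r = 32) := by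
  have hp2' : (2:ℤ) ≤ p := by exact_mod_cast hp.two_le
  have hp1 : ((p:ℤ) - 1) ≠ 0 := by linarith
  obtain ⟨b, rfl⟩ := ha
  have hb : 1 ≤ b := by omega
  have hQb : p^(b+b) = p^b * p^b := pow_add p b b
  have hpb : 2 ≤ p^b := hp.two_le.trans (Nat.le_self_pow (by omega) p)
  obtain ⟨s, hs⟩ : ((p:ℤ) + 1) ∣ (p:ℤ)^(b+b) - 1 := by
    have h1 : ((p:ℤ)^2 - 1) ∣ ((p:ℤ)^2)^b - 1 := by
      simpa using sub_dvd_pow_sub_pow ((p:ℤ)^2) 1 b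
    rw [← pow_mul, two_mul] at h1
    refine dvd_trans ⟨(p:ℤ)-1, by ring⟩ h1
  have hN' : (N:ℤ) = (p^(b+b)-1) * (p+1) := mul_left_cancel₀ hp1 (by rw [hN]; ring)
  rw [pow_mul] at hrk hd
  generalize hQ : p^(b+b) = Q at *
  have hQ' : (p:ℤ)^(b+b) = Q := by exact_mod_cast hQ
  rw [hQ'] at hrk hN hN' hs
  have hQ4 : 4 ≤ Q := by rw [hQb]; nlinarith
  have hrn' : (r:ℤ) * n = N * 2 := by exact_mod_cast hrn
  have hkr' : (k:ℤ) ≤ r := by exact_mod_cast hkr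
  have hk2' : (2:ℤ) < k := by exact_mod_cast hk2
  have hr0 : (0:ℤ) < r := by linarith
  have hQ4' : (4:ℤ) ≤ Q := by exact_mod_cast hQ4
  have hdv : (r:ℤ) ∣ 4 * (Q - 1) := by
    have h1 : (r:ℤ) ∣ 2 * (Q^2-1) := ⟨_, hrk.symm⟩
    have h2 : (r:ℤ) ∣ s * (N * 2) := Dvd.dvd.mul_left ⟨_, hrn'.symm⟩ _
    have := dvd_sub h1 h2
    refine dvdE this ?_
    rw [hN']; linear_combination (-2) * (Q-1 : ℤ) * hs
  obtain ⟨m, hm⟩ := hdv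
  have hm0 : 0 < m := by
    by_contra h
    push Not at h
    have := mul_nonpos_of_nonneg_of_nonpos hr0.le h
    linarith
  have hkm : 2 * ((k:ℤ) - 1) = m * (Q + 1) := by
    have : (r:ℤ) * (2 * ((k:ℤ) - 1)) = r * (m * (Q+1)) := by
      linear_combination 2 * hrk + (Q+1 : ℤ) * hm
    exact mul_left_cancel₀ hr0.ne' this
  have hm2 : m < 3 := by
    by_contra h
    push Not at h
    have h1 : m * (m * (Q+1)) < 2 * (4 * (Q-1)) := by
      rw [← hkm, hm]; nlinarith
    have h2 : 3 * (3 * ((Q:ℤ)+1)) ≤ m * (m * (Q+1)) := by gcongr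
    linarith
  have hpow : ∀ q : ℕ, q.Prime → p^b = q → p = q ∧ b = 1 := by
    intro q hq h
    have hpb := h ▸ hq
    have hb1 : b = 1 := hpb.eq_one_of_pow
    subst hb1; simp at h; exact ⟨h, rfl⟩
  have : m = 1 ∨ m = 2 := by omega
  rcases this with rfl | rfl
  · have hr8 : (r:ℤ) = 8 * k - 16 := by linarith
    have hQk : Q + 3 = 2 * k := by omega
    rcases hd with hd | hd
    · exfalso
      have : (k:ℤ) ∣ 16 := by
        have h1 : (k:ℤ) ∣ r := by exact_mod_cast hd
        have := dvd_sub (Dvd.intro 8 rfl : (k:ℤ) ∣ k * 8) h1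
        rw [hr8] at this; refine dvdE this ?_; ring
      have h16 : k ∣ 16 := by exact_mod_cast this
      have hle := Nat.le_of_dvd (by norm_num) h16
      have h29 : Q ≤ 29 := by omega
      have hx : p^b < 6 := by
        by_contra h
        have := Nat.mul_le_mul (not_lt.1 h) (not_lt.1 h)
        omega
      rw [hQb] at hQk
      generalize p^b = x at *
      interval_cases x
      · omega
      · have : k = 6 := by omega
        subst this; omega
      · omega
      · have : k = 14 := by omega
        subst this; omega
    · have h1 : Q + 3 ∣ 4 * Q^2 := by
        rw [hQk]; exact (mul_dvd_mul_left 2 hd).trans ⟨1, by ring⟩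
      right
      have h3 : Q + 3 ∣ 36 := by
        have : ((Q+3 : ℕ):ℤ) ∣ ((4 * Q^2 : ℕ) : ℤ) := by exact_mod_cast h1
        have h2 : ((Q+3 : ℕ):ℤ) ∣ ((Q+3 : ℕ):ℤ) * (4*Q-12) := Dvd.intro _ rfl
        have := dvd_sub this h2
        have h3 : ((Q+3 : ℕ):ℤ) ∣ 36 := by
          refine dvdE this ?_; push_cast; ring
        exact_mod_cast h3
      have hle := Nat.le_of_dvd (by norm_num) h3
      have hx : p^b < 6 := by
        by_contra h
        have := Nat.mul_le_mul (not_lt.1 h) (not_lt.1 h)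
        omega
      rw [hQb] at hQk h3
      have : p^b = 3 := by
        generalize p^b = x at *
        interval_cases x <;> first | rfl | (exfalso; revert h3; decide)
      obtain ⟨rfl, rfl⟩ := hpow 3 (by norm_num) this
      norm_num at hQk
      refine ⟨rfl, rfl, by omega, by omega⟩
  · have hQk : Q + 2 = k := by omega
    have hr8 : (r:ℤ) = 2 * k - 6 := by omega
    rcases hd with hd | hd
    · left
      have : (k:ℤ) ∣ 6 := by
        have h1 : (k:ℤ) ∣ r := by exact_mod_cast hd
        have := dvd_sub (Dvd.intro 2 rfl : (k:ℤ) ∣ k * 2) h1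
        rw [hr8] at this; refine dvdE this ?_; ring
      have h16 : k ∣ 6 := by exact_mod_cast this
      have hle := Nat.le_of_dvd (by norm_num) h16
      have hx : p^b = 2 := by
        have : p^b < 3 := by
          by_contra h
          have := Nat.mul_le_mul (not_lt.1 h) (not_lt.1 h)
          omega
        omega
      obtain ⟨rfl, rfl⟩ := hpow 2 (by norm_num) hx
      norm_num at hQb
      refine ⟨rfl, rfl, by omega, by omega⟩
    · exfalso
      have h3 : Q + 2 ∣ 8 := by
        have : ((Q+2 : ℕ):ℤ) ∣ ((2 * Q^2 : ℕ) : ℤ) := by rw [hQk]; exact_mod_cast hd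
        have h2 : ((Q+2 : ℕ):ℤ) ∣ ((Q+2 : ℕ):ℤ) * (2*Q-4) := Dvd.intro _ rfl
        have := dvd_sub this h2
        have h3 : ((Q+2 : ℕ):ℤ) ∣ 8 := by
          refine dvdE this ?_; push_cast; ring
        exact_mod_cast h3
      have hle := Nat.le_of_dvd (by norm_num) h3
      have : Q < 7 := by omega
      have hx : p^b = 2 := by
        have : p^b < 3 := by
          by_contra h
          have := Nat.mul_le_mul (not_lt.1 h) (not_lt.1 h)
          omega
        omega
      rw [hQb, hx] at h3
      revert h3; decide
end Ar

namespace Ar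

theorem sq_dvd (p k n : ℕ) (hp : p.Prime) (h : k ∣ 2 * p^n) (hk : 2 * p < k ∨ (p = 2 ∧ 2 < k)) : p^2 ∣ k := by
  rcases hk with hk | ⟨rfl, hk⟩
  · obtain ⟨x, y, hx, hy, rfl⟩ := (Nat.dvd_mul).1 h
    obtain ⟨j, hj, rfl⟩ := (Nat.dvd_prime_pow hp).1 hy
    have hx2 := Nat.le_of_dvd (by norm_num) hx
    apply Dvd.dvd.mul_left
    apply pow_dvd_pow
    by_contra hj2
    have : j = 0 ∨ j = 1 := by omega
    have h1 : p^j ≤ p := by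
      rcases this with rfl | rfl
      · simpa using hp.one_le
      · simp
    have := Nat.mul_le_mul hx2 h1
    omega
  · have h' : k ∣ 2^(n+1) := by rw [pow_succ, mul_comm]; exact h
    obtain ⟨j, hj, rfl⟩ := (Nat.dvd_prime_pow hp).1 h'
    apply pow_dvd_pow
    by_contra hj2
    have : j = 0 ∨ j = 1 := by omega
    rcases this with rfl | rfl <;> simp at hk

set_option maxHeartbeats 2000000 in
theorem odd2 (p a N r m k : ℕ) (hp : p.Prime) (ha : Odd a) (ha2 : 2 ≤ a)
    (hN : ((p:ℤ) - 1) * N = (p^a-1) * (p^2-1)) (hre : Even r)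
    (hrn : r * m = N * 2) (hrk : (r:ℤ) * (k - 1) = 2 * (p^(a*2) - 1)) (hkr : k ≤ r) (hk2 : 2 < k)
    (hd : k ∣ r ∨ k ∣ 2 * p^(a*2)) :
    (p = 2 ∧ a = 3 ∧ k = 4 ∧ r = 42) ∨ (p = 3 ∧ a = 3 ∧ k = 8 ∧ r = 208) ∨
    (p = 11 ∧ a = 3 ∧ k = 112 ∧ r = 31920) := by
  have hp2' : (2:ℤ) ≤ p := by exact_mod_cast hp.two_le
  have hp1 : ((p:ℤ) - 1) ≠ 0 := by linarith
  have ha3 : 3 ≤ a := by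
    rcases ha with ⟨b, rfl⟩; omega
  obtain ⟨b, rfl⟩ : ∃ b, a = b + 2 := ⟨a - 2, by omega⟩
  have hbo : Odd b := by
    rcases ha with ⟨b', hb'⟩; exact ⟨b' - 1, by omega⟩
  have hN' : (N:ℤ) = (p^(b+2)-1) * (p+1) := mul_left_cancel₀ hp1 (by rw [hN]; ring)
  obtain ⟨s, hs⟩ : ((p:ℤ) + 1) ∣ (p:ℤ)^b + 1 := by
    simpa using hbo.add_dvd_pow_add_pow (p:ℤ) 1
  set Z : ℤ := (p:ℤ)^b with hZ
  have hZ2 : (2:ℤ) ≤ Z := by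
    have : p ≤ p^b := Nat.le_self_pow (by omega) p
    have : (p:ℤ) ≤ Z := by rw [hZ]; exact_mod_cast this
    linarith
  have hQ : (p:ℤ)^(b+2) = p^2 * Z := by rw [pow_add, hZ]; ring
  have hs0 : 0 < s := by
    by_contra h
    push Not at h
    clear * - h hs hZ2 hp2'
    nlinarith
  set D : ℤ := p^2 * s + 1 - p with hD
  have hDQ : (p+1) * D = p^2 * Z + 1 := by rw [hD]; linear_combination (-(p:ℤ)^2) * hs
  rw [hQ] at hN'
  have hrk' : (r:ℤ) * (k - 1) = 2 * ((p^2*Z-1) * (p^2*Z+1)) := by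
    rw [hrk, pow_mul, hQ]; ring
  have hrn' : (r:ℤ) * m = N * 2 := by exact_mod_cast hrn
  have hkr' : (k:ℤ) ≤ r := by exact_mod_cast hkr
  have hk2' : (2:ℤ) < k := by exact_mod_cast hk2
  have hr0 : (0:ℤ) < r := by linarith
  have hp4 : (4:ℤ) ≤ p^2 := by nlinarith
  have hQ8 : (8:ℤ) ≤ p^2*Z := by clear * - hp4 hZ2; nlinarith
  have hNpos : (0:ℤ) < N := by rw [hN']; apply mul_pos <;> linarith
  have hm0 : (0:ℤ) < m := by
    rcases Nat.eq_zero_or_pos m with h | h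
    · subst h; simp at hrn'; linarith
    · exact_mod_cast h
  have hk : (k:ℤ) = 1 + m * D := by
    have h2 : (r:ℤ) * (2 * (N * (k-1))) = r * (2 * (N * (m * D))) := by
      have : (N:ℤ) * D = (p^2*Z-1) * (p^2*Z+1) := by rw [hN']; linear_combination (p^2*Z-1) * hDQ
      linear_combination (2 * N : ℤ) * hrk' - 2 * (N * D) * hrn' - (4*N:ℤ) * this
    have h3 := mul_left_cancel₀ hr0.ne' h2
    have h4 := mul_left_cancel₀ hNpos.ne' (mul_left_cancel₀ two_ne_zero h3)
    linarith
  have hDp : (p:ℤ)^2 + 1 - p ≤ D := by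
    rw [hD]; clear * - hp4 hs0; nlinarith
  have hD0 : 0 < D := by clear * - hDp hp2'; nlinarith
  have hNm : (N:ℤ) = (p+1)^2 * D - 2 * (p+1) := by rw [hN']; linear_combination (-(p:ℤ)-1) * hDQ
  have hmb : (m:ℤ)^2 < 2 * (p+1)^2 := by
    have h1 : (m:ℤ) * k ≤ N * 2 := by rw [← hrn', mul_comm]; gcongr
    rw [hk, hNm] at h1
    by_contra h
    push Not at h
    have := mul_le_mul_of_nonneg_right h hD0.le
    clear * - this h1 hm0 hp2'
    nlinarith
  rcases hd with hd | hd
  · obtain ⟨t, ht⟩ := hd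
    have ht' : (r:ℤ) = k * t := by exact_mod_cast ht
    have ht0 : (0:ℤ) < t := by
      rcases Nat.eq_zero_or_pos t with h | h
      · subst h; simp at ht'; linarith
      · exact_mod_cast h
    have key : D * (2 * (p+1)^2 - t * m^2) = t * m + 4 * (p+1) := by
      have : (k:ℤ) * t * m = ((p+1)^2 * D - 2 * (p+1)) * 2 := by rw [← ht', hrn', hNm]
      rw [hk] at this
      linear_combination -this
    set X : ℤ := 2 * (p+1)^2 - t * m^2 with hX
    have hX0 : 0 < X := by
      by_contra h
      push Not at h
      have := mul_nonpos_of_nonneg_of_nonpos hD0.le h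
      have : (0:ℤ) < t * m := by positivity
      linarith
    have htm : (t:ℤ) * m ≤ t * m^2 := by
      have : (m:ℤ) ≤ m^2 := by exact_mod_cast Nat.le_self_pow two_ne_zero m
      gcongr
    have hDle : D ≤ t * m + 4 * (p+1) := by rw [← key]; exact le_mul_of_one_le_right hD0.le hX0
    have hDb : D < 2 * (p+1)^2 + 4 * (p+1) := by linarith
    -- a = 3 or p = 2, a = 5
    have hb : b = 1 ∨ (p = 2 ∧ b = 3) := by
      by_contra hne
      have hb3 : 3 ≤ b := by
        rcases hbo with ⟨b', rfl⟩; omega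
      rcases Nat.lt_or_ge p 3 with hp3 | hp3
      · have hp2 : p = 2 := by have := hp.two_le; omega
        subst hp2
        have hb5 : 5 ≤ b := by rcases hbo with ⟨b', rfl⟩; omega
        have : (2:ℤ)^5 ≤ Z := by
          rw [hZ]; push_cast; exact pow_le_pow_right₀ (by norm_num : (1:ℤ) ≤ 2) hb5
        push_cast at *
        linarith
      · have : (p:ℤ)^3 ≤ Z := by
          rw [hZ]; gcongr; linarith
        obtain ⟨y, hy⟩ : ∃ y : ℤ, (p:ℤ) = 3 + y := ⟨p - 3, by ring⟩
        have hy0 : 0 ≤ y := by have : (3:ℤ) ≤ p := by exact_mod_cast hp3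
                               linarith
        have h1 : (p:ℤ)^2 * p^3 ≤ p^2 * Z := by gcongr
        have h2 : (p+1) * D < (p+1) * (2 * (p+1)^2 + 4 * (p+1)) := by
          apply mul_lt_mul_of_pos_left hDb; linarith
        have h3 : (0:ℤ) < p^2*p^3 + 1 - (p+1) * (2 * (p+1)^2 + 4 * (p+1)) := by
          rw [hy]; ring_nf; positivity
        linarith
    rcases hb with rfl | ⟨rfl, rfl⟩
    · -- a = 3
      have hDe : D = p^2 - p + 1 := by
        have : ((p:ℤ)+1) * D = (p+1) * (p^2-p+1) := by rw [hDQ, hZ]; ring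
        exact mul_left_cancel₀ (by linarith) this
      rcases Nat.lt_or_ge p 20 with hp20 | hp20
      · have hC : m * (1 + m * (p^2 - p + 1)) * t = 2 * (p^3-1) * (p+1) := by
          zify [(by exact Nat.le_self_pow two_ne_zero p : p ≤ p^2), (Nat.one_le_pow _ _ hp.pos : 1 ≤ p^3)]
          rw [← hDe, ← hk]
          have : (m:ℤ) * k * t = N * 2 := by rw [← hrn', ht']; ring
          rw [this, hN', hZ]; ring
        have hCd : m * (1 + m * (p^2 - p + 1)) ∣ 2 * (p^3-1) * (p+1) := ⟨t, hC.symm⟩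
        have hm29 : m < 29 := by
          by_contra h
          have h1 : (29:ℤ) ≤ m := by exact_mod_cast not_lt.1 h
          have h2 : (p:ℤ) ≤ 19 := by
            have : p ≤ 19 := by omega
            exact_mod_cast this
          clear * - h1 h2 hmb hp2'
          nlinarith
        have hm0' : 0 < m := by exact_mod_cast hm0
        have fin : p < 20 → p.Prime → 0 < m → m < 29 → m * (1 + m * (p^2 - p + 1)) ∣ 2 * (p^3-1) * (p+1) →
            (p = 2 ∧ m = 2) ∨ (p = 3 ∧ m = 1) ∨ (p = 11 ∧ m = 1) := by
          clear * -
          intro h1 h2 h3 h4 h5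
          have hpl : p = 2 ∨ p = 3 ∨ p = 5 ∨ p = 7 ∨ p = 11 ∨ p = 13 ∨ p = 17 ∨ p = 19 := by
            interval_cases p <;> first | omega | (exfalso; revert h2; norm_num)
          have hpd : ∀ q ∈ [2,3,5,7,11,13,17,19], ∀ m < 29, 0 < m →
              m * (1 + m * (q^2 - q + 1)) ∣ 2 * (q^3-1) * (q+1) →
              (q = 2 ∧ m = 2) ∨ (q = 3 ∧ m = 1) ∨ (q = 11 ∧ m = 1) := by decide
          exact hpd p (by simpa using hpl) m h4 h3 h5
        rcases fin hp20 hp hm0' hm29 hCd with ⟨rfl, rfl⟩ | ⟨rfl, rfl⟩ | ⟨rfl, rfl⟩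
        · exfalso
          have : t = 3 := by omega
          subst this
          push_cast at hDe hk
          rw [hDe] at hk
          have : k = 7 := by omega
          subst this
          subst ht
          revert hre; decide
        · right; left
          have : t = 26 := by omega
          push_cast at hDe hk
          rw [hDe] at hk
          have : k = 8 := by omega
          subst this
          refine ⟨rfl, rfl, rfl, by omega⟩
        · right; right
          have : t = 285 := by omega
          push_cast at hDe hk
          rw [hDe] at hk
          have : k = 112 := by omega
          subst this
          refine ⟨rfl, rfl, rfl, by omega⟩
      · exfalso
        have hp20' : (20:ℤ) ≤ p := by exact_mod_cast hp20
        have hm0' : 0 < m := by exact_mod_cast hm0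
        have hr' : (r:ℤ) * m = 2 * ((p^3-1) * (p+1)) := by rw [hrn', hN', hZ]; ring
        rcases Nat.lt_or_ge m 3 with h3 | h3
        · have : m = 1 ∨ m = 2 := by omega
          rcases this with rfl | rfl
          · push_cast at hk hr'
            have hd1 : (k:ℤ) ∣ 10 * p + 2 := by
              refine ⟨2*p^2+4*p - t, ?_⟩
              have : (k:ℤ) * t = 2 * ((p^3-1) * (p+1)) := by rw [← ht']; linarith
              rw [mul_sub, this, hk, hDe]; ring
            have := Int.le_of_dvd (by linarith) hd1
            rw [hk, hDe] at this
            clear * - this hp20'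
            nlinarith
          · push_cast at hk hr'
            have hd1 : (k:ℤ) ∣ 14 * p + 7 := by
              refine ⟨2*p^2+4*p+1 - 4 * t, ?_⟩
              have : (k:ℤ) * t = ((p^3-1) * (p+1)) := by rw [← ht']; linarith
              have h4 : (k:ℤ) * (4 * t) = 4 * ((p^3-1) * (p+1)) := by rw [← this]; ring
              rw [mul_sub, h4, hk, hDe]; ring
            have := Int.le_of_dvd (by linarith) hd1
            rw [hk, hDe] at this
            clear * - this hp20'
            nlinarith
        · have h3' : (3:ℤ) ≤ m := by exact_mod_cast h3
          have h4 : (t:ℤ) * m * 3 ≤ t * m^2 := by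
            have : (t:ℤ) * m * 3 ≤ t * m * m := by gcongr
            linarith
          rw [hDe] at hDle
          clear * - hDle h4 hX hX0 hp20'
          nlinarith
    · exfalso
      have hZ8 : Z = 8 := by rw [hZ]; norm_num
      have hDe : D = 11 := by rw [hZ8] at hDQ; push_cast at hDQ; linarith
      push_cast at hmb
      have : m < 5 := by
        by_contra h
        have h1 : (5:ℤ) ≤ m := by exact_mod_cast not_lt.1 h
        clear * - h1 hmb
        nlinarith
      rw [hDe, hX] at key
      push_cast at key
      have : m = 1 ∨ m = 2 ∨ m = 3 ∨ m = 4 := by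
        have : 0 < m := by exact_mod_cast hm0
        omega
      rcases this with rfl | rfl | rfl | rfl <;> (push_cast at key; omega)
  · have hpk : p^2 ∣ k := by
      apply sq_dvd p k _ hp hd
      rcases Nat.lt_or_ge p 3 with h | h
      · right; have := hp.two_le; exact ⟨by omega, hk2⟩
      · left
        have h3 : (3:ℤ) ≤ p := by exact_mod_cast h
        have : (2:ℤ) * p < k := by
          rw [hk]
          have : D ≤ m * D := le_mul_of_one_le_left hD0.le hm0
          clear * - this hDp h3
          nlinarith
        exact_mod_cast this
    obtain ⟨y, hy⟩ : (p:ℤ)^2 ∣ m * (p-1) - 1 := by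
      have h1 : (p:ℤ)^2 ∣ k := by exact_mod_cast hpk
      have h2 : (p:ℤ)^2 ∣ p^2 * (m*s) := Dvd.intro _ rfl
      have := dvd_sub h2 h1
      refine dvdE this ?_
      rw [hk, hD]; ring
    -- p ≤ 3
    have hmy : (p:ℤ)^2 ∣ m + p + 1 := by
      refine ⟨m - y * (p+1), ?_⟩
      linear_combination (-(p:ℤ)-1) * hy
    have hmle := Int.le_of_dvd (by linarith) hmy
    have hp4 : p < 4 := by
      by_contra h
      have h4 : (4:ℤ) ≤ p := by exact_mod_cast not_lt.1 h
      have h5 : (p:ℤ)^2 - p - 1 ≤ m := by linarith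
      have h6 : 2 * (p+1:ℤ) ≤ p^2-p-1 + 0 ∨ (p:ℤ) = 4 := by
        rcases eq_or_lt_of_le h4 with h | h
        · right; exact h.symm
        · left; clear * - h; have : (5:ℤ) ≤ p := h; nlinarith
      rcases h6 with h6 | h6
      · clear * - h6 h5 hmb h4; nlinarith
      · have : p = 4 := by exact_mod_cast h6
        subst this; revert hp; norm_num
    have : p = 2 ∨ p = 3 := by have := hp.two_le; omega
    rcases this with rfl | rfl
    · left
      push_cast at *
      have hm5 : m < 5 := by
        by_contra h
        have h1 : (5:ℤ) ≤ m := by exact_mod_cast not_lt.1 h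
        clear * - h1 hmb
        nlinarith
      have hm1 : m = 1 := by
        clear * - hmy hm5 hm0; omega
      subst hm1
      push_cast at hk
      have hk4 : (k:ℤ) = 4 * s := by rw [hk, hD]; ring
      have hsodd : ¬ (2:ℤ) ∣ s := by
        intro h
        have : (2:ℤ) ∣ Z := by rw [hZ]; exact dvd_pow_self 2 (by omega)
        clear * - this hs h
        omega
      have hs1 : s = 1 := by
        have h1 : s.natAbs ∣ 2 * 2^((b+2)*2) := by
          refine dvd_trans ?_ hd
          have : s ∣ (k:ℤ) := ⟨4, by rw [hk4]; ring⟩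
          exact Int.natAbs_dvd_natAbs.2 this
        have h2 : Nat.Coprime s.natAbs (2 * 2^((b+2)*2)) := by
          rw [← pow_succ']
          apply Nat.Coprime.pow_right
          rw [Nat.coprime_comm, Nat.prime_two.coprime_iff_not_dvd]
          clear * - hsodd
          omega
        have := Nat.eq_one_of_dvd_coprimes h2 dvd_rfl h1
        clear * - this hs0
        omega
      subst hs1
      have hZe : Z = 2 := by linarith
      have hb : b = 1 := by
        have h2 : 2^b = 2^1 := by
          have : ((2:ℤ))^b = 2^1 := by rw [pow_one]; linarith
          exact_mod_cast this
        exact Nat.pow_right_injective le_rfl h2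
      subst hb
      rw [hZe] at hN'
      refine ⟨by norm_num, by norm_num, by clear * - hk4; omega, by clear * - hrn' hN'; omega⟩
    · exfalso
      push_cast at *
      have hm6 : m < 6 := by
        by_contra h
        have h1 : (6:ℤ) ≤ m := by exact_mod_cast not_lt.1 h
        clear * - h1 hmb
        nlinarith
      have hm1 : m = 5 := by
        clear * - hmy hm6 hm0; omega
      subst hm1
      push_cast at hk
      have hk4 : (k:ℤ) = 9 * (5 * s - 1) := by rw [hk, hD]; ring
      have h3 : (3:ℤ) ∣ Z := by rw [hZ]; exact dvd_pow_self 3 (by omega)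
      have h1 : (5*s-1).natAbs ∣ 2 * 3^((b+2)*2) := by
        refine dvd_trans ?_ hd
        have : (5*s-1) ∣ (k:ℤ) := ⟨9, by rw [hk4]; ring⟩
        exact Int.natAbs_dvd_natAbs.2 this
      have h2 : Nat.Coprime (5*s-1).natAbs (3^((b+2)*2)) := by
        apply Nat.Coprime.pow_right
        rw [Nat.coprime_comm, Nat.prime_three.coprime_iff_not_dvd]
        clear * - hs h3
        omega
      have := Nat.le_of_dvd (by norm_num) (h2.dvd_of_dvd_mul_right h1)
      clear * - this hs0
      omega
end Ar

namespace Ar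

set_option maxHeartbeats 4000000 in
theorem main (p a c N r n k : ℕ) (hp : p.Prime) (hc : 2 ≤ c) (hca : c ≤ a)
    (hN : (p - 1) * N = (p^a-1) * (p^c-1)) (hre : Even r)
    (hrn : r * n = N * 2) (hrk : r * (k - 1) = 2 * (p^(a*c) - 1)) (hkr : k ≤ r) (hk2 : 2 < k)
    (hd : k ∣ r ∨ k ∣ 2 * p^(a*c)) :
    (p = 2 ∧ a = 2 ∧ c = 2 ∧ k = 6 ∧ r = 6) ∨
    (p = 3 ∧ a = 2 ∧ c = 2 ∧ k = 6 ∧ r = 32) ∨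
    (p = 2 ∧ a = 3 ∧ c = 2 ∧ k = 4 ∧ r = 42) ∨
    (p = 3 ∧ a = 3 ∧ c = 2 ∧ k = 8 ∧ r = 208) ∨ (p = 11 ∧ a = 3 ∧ c = 2 ∧ k = 112 ∧ r = 31920) := by
  have hp2 := hp.two_le
  have hNz : ((p:ℤ) - 1) * N = (p^a-1) * (p^c-1) := by
    have h := congrArg (Nat.cast : ℕ → ℤ) hN
    rw [Nat.cast_mul, Nat.cast_mul, Nat.cast_sub hp.one_le, Nat.cast_sub (Nat.one_le_pow _ _ hp.pos),
      Nat.cast_sub (Nat.one_le_pow _ _ hp.pos)] at h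
    simpa using h
  have hrkz : (r:ℤ) * (k - 1) = 2 * (p^(a*c) - 1) := by
    have h := congrArg (Nat.cast : ℕ → ℤ) hrk
    rw [Nat.cast_mul, Nat.cast_mul, Nat.cast_sub (by omega), Nat.cast_sub (Nat.one_le_pow _ _ hp.pos)] at h
    simpa using h
  have hv : 1 ≤ p^(a*c) := Nat.one_le_pow _ _ hp.pos
  have hr2 : 2 * p^(a*c) ≤ r^2 := by
    have h1 : r * (k-1) ≤ r * (r-1) := Nat.mul_le_mul_left _ (by omega)
    rw [hrk] at h1
    have e : r * (r-1) + r = r * r := by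
      obtain ⟨s, rfl⟩ : ∃ s, r = s + 1 := ⟨r - 1, by omega⟩
      simp; ring
    rw [pow_two]; clear * - h1 e hv hk2 hkr; omega
  rcases eq_or_lt_of_le hc with rfl | hc3
  · rcases Nat.even_or_odd a with ha | ha
    · have h := even2 p a N r n k hp ha hca hNz hrn hrkz hkr hk2 hd
      clear * - h; tauto
    · have h := odd2 p a N r n k hp ha hca hNz hre hrn hrkz hkr hk2 hd
      clear * - h; tauto
  exfalso
  have hr2z : 2 * (p:ℤ)^(a*c) ≤ r^2 := by exact_mod_cast hr2
  have hNpos : 0 < N := by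
    rcases Nat.eq_zero_or_pos N with h | h
    · subst h
      have h1 : 2 ≤ p^a := hp2.trans (Nat.le_self_pow (by omega) p)
      have h2 : 2 ≤ p^c := hp2.trans (Nat.le_self_pow (by omega) p)
      have : 0 < (p^a-1)*(p^c-1) := Nat.mul_pos (by omega) (by omega)
      omega
    · exact h
  have hn0 : 0 < n := by
    rcases Nat.eq_zero_or_pos n with h | h
    · subst h; omega
    · exact h
  have hbound : (p-1)^2 * p^(a*c) < 2 * p^(2*a+2*c) := by
    have h1 : (p-1) * r ≤ 2 * ((p^a-1)*(p^c-1)) := by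
      rw [← hN]
      have : r ≤ N * 2 := by rw [← hrn]; exact Nat.le_mul_of_pos_right _ hn0
      calc (p-1) * r ≤ (p-1) * (N*2) := Nat.mul_le_mul_left _ this
        _ = _ := by ring
    have h2 : (p^a-1)*(p^c-1) < p^a * p^c := by
      have h1 : 0 < p^a := pow_pos hp.pos _
      have h2 : 0 < p^c := pow_pos hp.pos _
      calc (p^a-1)*(p^c-1) ≤ (p^a - 1) * p^c := Nat.mul_le_mul_left _ (by omega)
        _ < p^a * p^c := Nat.mul_lt_mul_of_pos_right (by omega) h2
    have h3 : (p-1) * r < 2 * (p^a*p^c) := by omega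
    have h4 : ((p-1) * r)^2 < (2 * (p^a*p^c))^2 := Nat.pow_lt_pow_left h3 two_ne_zero
    have h5 : (p-1)^2 * (2 * p^(a*c)) ≤ (p-1)^2 * r^2 := Nat.mul_le_mul_left _ hr2
    have h6 : p^(2*a+2*c) = (p^a*p^c)^2 := by rw [pow_add, mul_comm 2 a, mul_comm 2 c, pow_mul, pow_mul]; ring
    rw [h6]
    nlinarith
  obtain ⟨x, rfl⟩ : ∃ x, a = x + 2 := ⟨a-2, by omega⟩
  obtain ⟨y, rfl⟩ : ∃ y, c = y + 2 := ⟨c-2, by omega⟩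
  have hexp : (x+2)*(y+2) + 4 = 2*(x+2)+2*(y+2) + x*y := by ring
  rcases Nat.lt_or_ge p 5 with h5 | h5
  · have hp' : p = 2 ∨ p = 3 := by
      have : p ≠ 4 := by rintro rfl; revert hp; norm_num
      omega
    rcases hp' with rfl | rfl
    · have h1 : x * y ≤ 4 := by
        have : 2^((x+2)*(y+2)) < 2^(2*(x+2)+2*(y+2)+1) := by rw [pow_succ]; omega
        have := (Nat.pow_lt_pow_iff_right (by norm_num)).1 this
        omega
      have hy : y ≤ 2 := by by_contra h; nlinarith
      have hx : x ≤ 4 := by nlinarith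
      have hy1 : 1 ≤ y := by omega
      have : (x = 1 ∧ y = 1) ∨ (x = 2 ∧ y = 1) ∨ (x = 3 ∧ y = 1) ∨ (x = 4 ∧ y = 1) ∨ (x = 2 ∧ y = 2) := by
        interval_cases y <;> omega
      rcases this with ⟨rfl, rfl⟩ | ⟨rfl, rfl⟩ | ⟨rfl, rfl⟩ | ⟨rfl, rfl⟩ | ⟨rfl, rfl⟩
      · exact c33 2 N r n le_rfl hNz hrn _ hrkz hr2z
      · norm_num at hN hrk hr2 hd
        obtain rfl : N = 105 := by omega
        have := conc (v := 4096) (M := 3) hrn (by omega) (by norm_num)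
        interval_cases n
        · obtain rfl : r = 210 := by omega
          obtain rfl : k = 40 := by omega
          revert hd; decide
        · obtain rfl : r = 105 := by omega
          obtain rfl : k = 79 := by omega
          revert hd; decide
      · norm_num at hN hrk hr2 hd
        obtain rfl : N = 217 := by omega
        have := conc (v := 32768) (M := 2) hrn (by omega) (by norm_num)
        interval_cases n
        · obtain rfl : r = 434 := by omega
          obtain rfl : k = 152 := by omega
          revert hd; decide
      · norm_num at hN hrk hr2 hd
        obtain rfl : N = 441 := by omega
        have := conc (v := 262144) (M := 2) hrn (by omega) (by norm_num)
        interval_cases n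
        · obtain rfl : r = 882 := by omega
          omega
      · norm_num at hN hrk hr2 hd
        obtain rfl : N = 225 := by omega
        have := conc (v := 65536) (M := 2) hrn (by omega) (by norm_num)
        interval_cases n
        · obtain rfl : r = 450 := by omega
          omega
    · have h1 : x * y < 4 := by
        have : 3^((x+2)*(y+2)) < 3^(2*(x+2)+2*(y+2)) := by norm_num at hbound ⊢; omega
        have := (Nat.pow_lt_pow_iff_right (by norm_num)).1 this
        omega
      have hy : y ≤ 1 := by by_contra h; nlinarith
      have hy1 : y = 1 := by omega
      subst hy1
      have : x = 1 ∨ x = 2 ∨ x = 3 := by omega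
      rcases this with rfl | rfl | rfl
      · exact c33 3 N r n (by norm_num) hNz hrn _ hrkz hr2z
      · norm_num at hN hrk hr2 hd
        obtain rfl : N = 1040 := by omega
        have := conc (v := 531441) (M := 3) hrn (by omega) (by norm_num)
        interval_cases n
        · obtain rfl : r = 2080 := by omega
          obtain rfl : k = 512 := by omega
          revert hd; decide
        · obtain rfl : r = 1040 := by omega
          obtain rfl : k = 1023 := by omega
          revert hd; decide
      · norm_num at hN hrk hr2 hd
        obtain rfl : N = 3146 := by omega
        have := conc (v := 14348907) (M := 2) hrn (by omega) (by norm_num)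
        interval_cases n
        · obtain rfl : r = 6292 := by omega
          obtain rfl : k = 4562 := by omega
          revert hd; decide
  · have h1 : x * y < 3 := by
      have h2 : 2 * p ≤ (p-1)^2 := by
        obtain ⟨z, rfl⟩ : ∃ z, p = z + 5 := ⟨p - 5, by omega⟩
        simp only [Nat.add_succ_sub_one]; nlinarith
      have : p^((x+2)*(y+2)+1) < p^(2*(x+2)+2*(y+2)) := by
        rw [pow_succ]
        have := Nat.mul_le_mul_right (p^((x+2)*(y+2))) h2
        nlinarith
      have := (Nat.pow_lt_pow_iff_right (by omega)).1 this
      omega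
    have hy : y ≤ 1 := by by_contra h; nlinarith
    have hy1 : y = 1 := by omega
    subst hy1
    have : x = 1 ∨ x = 2 := by omega
    rcases this with rfl | rfl
    · exact c33 p N r n (by omega) hNz hrn _ hrkz hr2z
    · exact c43 p N r n k hp h5 hNz hrn hrkz hkr hk2 hd
end Ar

namespace Ga
open MulAction
section
set_option linter.unusedSectionVars false
variable {W X : Type*} [Group W] [MulAction W X] [Finite W] [Finite X]

theorem ncard_orbit (K : Subgroup W) (x : X) : (orbit K x).ncard = (stabilizer W x).relIndex K := by
  rw [← index_stabilizer]; rfl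

theorem dvd_sub (K G : Subgroup W) (hKG : K ≤ G) (m : ℕ) (x : X) (hm : m ∣ (stabilizer W x).relIndex G)
    (hc : Nat.Coprime m (K.relIndex G)) : m ∣ (stabilizer W x).relIndex K := by
  have h1 := Subgroup.relIndex_mul_relIndex (stabilizer W x ⊓ K) K G inf_le_right hKG
  have h2 := Subgroup.relIndex_mul_relIndex (stabilizer W x ⊓ K) (stabilizer W x ⊓ G) G
    (inf_le_inf_left _ hKG) inf_le_right
  rw [Subgroup.inf_relIndex_right] at h1 h2
  have : m ∣ (stabilizer W x).relIndex K * K.relIndex G := by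
    rw [h1, ← h2]; exact hm.mul_left _
  exact hc.dvd_of_dvd_mul_right this

/-- an invariant set as a sub-action -/
def sma (K : Subgroup W) (Φ : Set X) (h : ∀ g ∈ K, ∀ x ∈ Φ, g • x ∈ Φ) : SubMulAction K X where
  carrier := Φ
  smul_mem' g x hx := h g g.2 x hx

theorem dvd_ncard (K : Subgroup W) (Φ : Set X) (h : ∀ g ∈ K, ∀ x ∈ Φ, g • x ∈ Φ) (m : ℕ)
    (hm : ∀ x ∈ Φ, m ∣ (stabilizer W x).relIndex K) : m ∣ Φ.ncard := by
  classical
  let Y := sma K Φ h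
  have e := selfEquivSigmaOrbitsQuotientStabilizer K Y
  have hc : Φ.ncard = Nat.card Y := rfl
  have : Finite Y := inferInstanceAs (Finite Φ)
  have : Fintype (orbitRel.Quotient K Y) := Fintype.ofFinite _
  rw [hc, Nat.card_congr e, Nat.card_sigma]
  refine Finset.dvd_sum fun ω _ => ?_
  have : Nat.card (K ⧸ stabilizer K ω.out) = (stabilizer W (ω.out : X)).relIndex K := by
    rw [← Subgroup.index_eq_card, SubMulAction.stabilizer_of_subMul]; rfl
  rw [this]
  exact hm _ ω.out.2

theorem fixed (q : ℕ) [Fact q.Prime] (K : Subgroup W) (hK : IsPGroup q K) (Φ : Set X)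
    (h : ∀ g ∈ K, ∀ x ∈ Φ, g • x ∈ Φ) (hq : ¬ q ∣ Φ.ncard) : ∃ x ∈ Φ, ∀ g ∈ K, g • x = x := by
  let Y := sma K Φ h
  have hc : Φ.ncard = Nat.card Y := rfl
  rw [hc] at hq
  obtain ⟨y, hy⟩ := hK.nonempty_fixed_point_of_prime_not_dvd_card Y hq
  exact ⟨y, y.2, fun g hg => congrArg Subtype.val (hy ⟨g, hg⟩)⟩
end

theorem conj_pow' {G : Type*} [Group G] (n y : G) (j : ℕ) (h : n * y * n⁻¹ = y ^ j) (i : ℕ) :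
    n ^ i * y * (n ^ i)⁻¹ = y ^ (j ^ i) := by
  induction i with
  | zero => simp
  | succ i ih =>
    calc n ^ (i+1) * y * (n ^ (i+1))⁻¹ = n * (n ^ i * y * (n ^ i)⁻¹) * n⁻¹ := by
          rw [pow_succ']; group
      _ = (n * y * n⁻¹) ^ (j^i) := by rw [ih, _root_.conj_pow]
      _ = _ := by rw [h, ← pow_mul, pow_succ']

theorem GT (G : Type*) [Group G] [Finite G] (h7 : 7 ∣ Nat.card G) (h49 : ¬ 49 ∣ Nat.card G)
    (h3 : ¬ 3 ∣ Nat.card G) (hinv : ∀ y n : G, orderOf y = 7 → n * y * n⁻¹ ≠ y⁻¹) :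
    ∃ (S : Sylow 2 G) (y : G), orderOf y = 7 ∧ ∀ s ∈ S, y * s * y⁻¹ ∈ S := by
  classical
  have : Fact (Nat.Prime 7) := ⟨by norm_num⟩
  have : Fact (Nat.Prime 2) := ⟨by norm_num⟩
  obtain ⟨P⟩ := (inferInstance : Nonempty (Sylow 7 G))
  have hPc : Nat.card P = 7 := by
    obtain ⟨e, he⟩ := IsPGroup.iff_card.1 P.2
    have h1 : Nat.card P ∣ Nat.card G := Subgroup.card_subgroup_dvd_card _
    have h2 := P.dvd_card_of_dvd_card h7
    change Nat.card P = _ at he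
    rw [he] at h1 h2 ⊢
    rcases e with _ | _ | e
    · norm_num at h2
    · norm_num
    · exact absurd ((pow_dvd_pow 7 (by omega : 2 ≤ e + 2)).trans h1) (by simpa using h49)
  have hP : Subgroup.normalizer (P : Subgroup G) ≤ Subgroup.centralizer (P : Set G) := by
    intro n hn
    rw [Subgroup.mem_centralizer_iff]
    intro y hy
    change y ∈ P at hy
    by_cases hy1 : y = 1
    · subst hy1; simp
    have hoy : orderOf y = 7 := by
      have h1 : orderOf y ∣ 7 := by
        rw [← hPc]
        have := orderOf_dvd_natCard (⟨y, hy⟩ : P)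
        rwa [Subgroup.orderOf_mk] at this
      rcases (Nat.dvd_prime (by norm_num)).1 h1 with h | h
      · exact absurd (orderOf_eq_one_iff.1 h) hy1
      · exact h
    have hz : Subgroup.zpowers y = (P : Subgroup G) := by
      apply Subgroup.eq_of_le_of_card_ge
      · rw [Subgroup.zpowers_le]; exact hy
      · rw [Nat.card_zpowers, hoy]; exact hPc.le
    have hn' : n * y * n⁻¹ ∈ (P : Subgroup G) := (Subgroup.mem_normalizer_iff.1 hn y).1 hy
    rw [← hz, mem_zpowers_iff_mem_range_orderOf] at hn'
    simp only [Finset.mem_image, Finset.mem_range] at hn'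
    obtain ⟨j, hj7, hj⟩ := hn'
    rw [hoy] at hj7
    have hpw : ∀ i, n ^ i * y * (n ^ i)⁻¹ = y ^ (j ^ i) := conj_pow' n y j hj.symm
    have h1 : y ^ (j ^ Nat.card G) = y ^ 1 := by rw [← hpw, pow_card_eq_one']; simp
    rw [pow_inj_mod, hoy] at h1
    have hjz : (j : ZMod 7) ^ Nat.card G = 1 := by
      have := (ZMod.natCast_eq_natCast_iff' _ _ 7).2 h1
      simpa using this
    have hG0 : Nat.card G ≠ 0 := Nat.card_pos.ne'
    have hu : IsUnit (j : ZMod 7) := IsUnit.of_pow_eq_one hjz hG0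
    have h6 : (j : ZMod 7) ^ 6 = 1 := by
      obtain ⟨u, hu⟩ := hu
      rw [← hu, ← Units.val_pow_eq_pow_val, ZMod.units_pow_card_sub_one_eq_one 7 u]; rfl
    have h2 : (j : ZMod 7) ^ 2 = 1 := by
      have hd : orderOf (j : ZMod 7) ∣ 6 := orderOf_dvd_of_pow_eq_one h6
      have hd' : orderOf (j : ZMod 7) ∣ Nat.card G := orderOf_dvd_of_pow_eq_one hjz
      apply orderOf_dvd_iff_pow_eq_one.1
      have : Nat.Coprime (orderOf (j : ZMod 7)) 3 := by
        rw [Nat.coprime_comm, (by norm_num : Nat.Prime 3).coprime_iff_not_dvd]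
        exact fun h => h3 (h.trans hd')
      exact this.dvd_of_dvd_mul_right (show _ ∣ 2 * 3 from hd)
    have : j = 1 ∨ j = 6 := by
      have h2' : ((j^2 : ℕ) : ZMod 7) = ((1:ℕ) : ZMod 7) := by push_cast; exact h2
      rw [ZMod.natCast_eq_natCast_iff'] at h2'
      have key : ∀ j < 7, j^2 % 7 = 1 % 7 → j = 1 ∨ j = 6 := by decide
      exact key j hj7 h2'
    rcases this with rfl | rfl
    · rw [pow_one] at hj
      rw [eq_mul_inv_iff_mul_eq] at hj; exact hj
    · exfalso
      refine hinv y n hoy ?_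
      rw [← hj, eq_inv_iff_mul_eq_one, ← pow_succ]
      have := pow_orderOf_eq_one y
      rwa [hoy] at this
  let M := (MonoidHom.transferSylow P hP).ker
  have hM7 : ¬ 7 ∣ Nat.card M := MonoidHom.not_dvd_card_ker_transferSylow P hP
  have hMc : Nat.card M * 7 = Nat.card G := by
    have := (MonoidHom.ker_transferSylow_isComplement' P hP).card_mul_card
    rw [← this]; congr 1; exact hPc.symm
  obtain ⟨S⟩ := (inferInstance : Nonempty (Sylow 2 M))
  let S' : Subgroup G := (S : Subgroup M).map M.subtype
  have hS'c : Nat.card S' = Nat.card S :=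
    Nat.card_congr (Subgroup.equivMapOfInjective _ _ M.subtype_injective).symm.toEquiv
  have hfr : Subgroup.normalizer (S' : Set G) ⊔ M = ⊤ := Sylow.normalizer_sup_eq_top S
  have hS'2 : IsPGroup 2 S' := S.2.map _
  have hind : ¬ 2 ∣ S'.index := by
    have e1 : Nat.card S * (S : Subgroup M).index = Nat.card M := Subgroup.card_mul_index _
    have e2 := Subgroup.card_mul_index S'
    rw [hS'c, ← hMc, ← e1, mul_assoc] at e2
    have e3 := Nat.eq_of_mul_eq_mul_left Nat.card_pos e2
    rw [e3]
    have := S.not_dvd_index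
    omega
  have h7N : 7 ∣ Nat.card (Subgroup.normalizer (S' : Set G)) := by
    have hMi : M.index = 7 := by
      have := Subgroup.card_mul_index M
      rw [← hMc] at this
      exact Nat.eq_of_mul_eq_mul_left Nat.card_pos this
    rw [← hMi, ← Subgroup.relIndex_top_right, ← hfr, sup_comm, Subgroup.relIndex_sup_left]
    exact Subgroup.relIndex_dvd_card _ _
  obtain ⟨y, hy⟩ := exists_prime_orderOf_dvd_card' 7 h7N
  refine ⟨hS'2.toSylow hind, y, by rw [Subgroup.orderOf_coe]; exact hy, fun s hs => ?_⟩
  exact (Subgroup.mem_normalizer_iff.1 y.2 s).1 hs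
end Ga

namespace Tn
set_option linter.unusedSectionVars false
variable {F E U : Type*} [Field F] [AddCommGroup E] [Module F E] [AddCommGroup U] [Module F U]

theorem dual_pair {b1 b2 : U} (h : b1 ∉ Submodule.span F {b2}) :
    ∃ φ : Module.Dual F U, φ b1 = 1 ∧ φ b2 = 0 := by
  obtain ⟨φ, h1, h2⟩ := Submodule.exists_le_ker_of_notMem h
  refine ⟨(φ b1)⁻¹ • φ, by simp [h1], ?_⟩
  have : φ b2 = 0 := h2 (Submodule.mem_span_singleton_self b2)
  simp [this]

theorem notMem_symm {b1 b2 : U} (h : b1 ∉ Submodule.span F {b2}) (h2 : b2 ≠ 0) :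
    b2 ∉ Submodule.span F {b1} := by
  intro h'
  obtain ⟨c, hc⟩ := Submodule.mem_span_singleton.1 h'
  apply h
  have hc0 : c ≠ 0 := by rintro rfl; simp at hc; exact h2 hc.symm
  exact Submodule.mem_span_singleton.2 ⟨c⁻¹, by rw [← hc, smul_smul, inv_mul_cancel₀ hc0, one_smul]⟩

theorem pair_lem {a1 a2 : E} {b1 b2 : U} (h : b1 ∉ Submodule.span F {b2}) (hb2 : b2 ≠ 0) (ha : a1 ≠ 0)
    (hR : a1 ⊗ₜ[F] b1 + a2 ⊗ₜ[F] b2 = 0 ∨ a1 ⊗ₜ[F] b1 + a2 ⊗ₜ[F] b2 ∈ R1 F E U) :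
    a2 ∈ Submodule.span F {a1} := by
  obtain ⟨φ1, h11, h12⟩ := dual_pair h
  obtain ⟨φ2, h22, h21⟩ := dual_pair (notMem_symm h hb2)
  rcases hR with h0 | ⟨a, -, b, -, h0⟩
  · have := congrArg (cr φ1) h0
    simp [h11, h12] at this
    exact absurd this ha
  · have e1 := congrArg (cr φ1) h0
    have e2 := congrArg (cr φ2) h0
    simp [h11, h12, h21, h22] at e1 e2
    rw [← e2, ← e1]
    have : φ1 b ≠ 0 := by intro h; rw [h] at e1; simp at e1; exact ha e1.symm
    exact Submodule.mem_span_singleton.2 ⟨φ2 b * (φ1 b)⁻¹, by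
      rw [smul_smul, mul_assoc, inv_mul_cancel₀ this, mul_one]⟩

theorem stepA [FiniteDimensional F E] [FiniteDimensional F U]
    (hlt : Module.finrank F U < Module.finrank F E) (u : (E ⊗[F] U) ≃ₗ[F] (E ⊗[F] U))
    (hu : ∀ x ∈ R1 F E U, u x ∈ R1 F E U) (w : U) (hw : w ≠ 0) :
    ∃ w' : U, w' ≠ 0 ∧ ∃ g : E →ₗ[F] E, ∀ f, u (f ⊗ₜ w) = g f ⊗ₜ[F] w' := by
  have hE : ∃ e : E, e ≠ 0 := by
    have : 0 < Module.finrank F E := by omega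
    have := Module.finrank_pos_iff.1 this
    exact exists_ne 0
  obtain ⟨e, he⟩ := hE
  have h1 : ∀ f : E, f ≠ 0 → ∃ α : E, α ≠ 0 ∧ ∃ β : U, β ≠ 0 ∧ α ⊗ₜ β = u (f ⊗ₜ w) :=
    fun f hf => hu _ (tmul_mem_R1 hf hw)
  have hsum : ∀ f1 f2 : E, u (f1 ⊗ₜ w) + u (f2 ⊗ₜ w) = 0 ∨ u (f1 ⊗ₜ w) + u (f2 ⊗ₜ w) ∈ R1 F E U := by
    intro f1 f2
    rw [← map_add, ← TensorProduct.add_tmul]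
    by_cases h : f1 + f2 = 0
    · left; rw [h]; simp
    · right; exact hu _ (tmul_mem_R1 h hw)
  obtain ⟨α0, hα0, β0, hβ0, h0⟩ := h1 e he
  by_cases hpar : ∀ f : E, f ≠ 0 → ∃ α : E, u (f ⊗ₜ w) = α ⊗ₜ β0
  · obtain ⟨φ, hφ⟩ := Module.Projective.exists_dual_eq_one F hβ0
    refine ⟨β0, hβ0, cr φ ∘ₗ u.toLinearMap ∘ₗ (TensorProduct.mk F E U).flip w, fun f => ?_⟩
    by_cases hf : f = 0
    · subst hf; simp
    · obtain ⟨α, hα⟩ := hpar f hf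
      simp [hα, hφ]
  · exfalso
    push Not at hpar
    obtain ⟨f1, hf1, hn⟩ := hpar
    obtain ⟨α1, hα1, β1, hβ1, h1'⟩ := h1 f1 hf1
    have hb : β1 ∉ Submodule.span F {β0} := by
      intro h
      obtain ⟨c, rfl⟩ := Submodule.mem_span_singleton.1 h
      exact hn (c • α1) (by rw [← h1', TensorProduct.smul_tmul])
    have hb' := notMem_symm hb hβ0
    have ha1 : α1 ∈ Submodule.span F {α0} :=
      pair_lem hb' hβ1 hα0 (by rw [h0, h1']; exact hsum _ _)
    obtain ⟨c, rfl⟩ := Submodule.mem_span_singleton.1 ha1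
    have hall : ∀ f : E, ∃ v : U, u (f ⊗ₜ w) = α0 ⊗ₜ v := by
      intro f
      by_cases hf : f = 0
      · exact ⟨0, by subst hf; simp⟩
      obtain ⟨α, hα, β, hβ, h⟩ := h1 f hf
      have hα' : α ∈ Submodule.span F {α0} := by
        by_cases hβ2 : β0 ∈ Submodule.span F {β}
        · have hβ3 : c • α0 ∈ Submodule.span F {α} → α ∈ Submodule.span F {α0} := by
            intro h
            obtain ⟨d, hd⟩ := Submodule.mem_span_singleton.1 h
            have hd0 : d ≠ 0 := by rintro rfl; rw [zero_smul] at hd; exact hα1 hd.symm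
            exact Submodule.mem_span_singleton.2 ⟨d⁻¹ * c, by
              rw [mul_smul, ← hd, smul_smul, inv_mul_cancel₀ hd0, one_smul]⟩
          apply hβ3
          refine pair_lem (b1 := β) (b2 := β1) ?_ hβ1 hα (by rw [h, h1']; exact hsum _ _)
          intro h4
          exact hb' ((Submodule.span_singleton_le_iff_mem _ _).2 h4 hβ2)
        · exact pair_lem (b1 := β0) (b2 := β) hβ2 hβ hα0 (by rw [h, h0]; exact hsum _ _)
      obtain ⟨d, rfl⟩ := Submodule.mem_span_singleton.1 hα'
      exact ⟨d • β, by rw [← h, TensorProduct.smul_tmul]⟩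
    obtain ⟨φ, hφ⟩ := Module.Projective.exists_dual_eq_one F hα0
    let ψ : E →ₗ[F] U := cl φ ∘ₗ u.toLinearMap ∘ₗ (TensorProduct.mk F E U).flip w
    have hψ : Function.Injective ψ := by
      rw [← LinearMap.ker_eq_bot, LinearMap.ker_eq_bot']
      intro f hf
      obtain ⟨v, hv⟩ := hall f
      by_contra hf0
      simp [ψ, hv, hφ] at hf
      subst hf
      simp at hv
      exact tmul_ne_zero hf0 hw hv
    have := LinearMap.finrank_le_finrank_of_injective hψ
    omega

/-- the tensor product homomorphism -/
noncomputable def Th : (E ≃ₗ[F] E) × (U ≃ₗ[F] U) →* ((E ⊗[F] U) ≃ₗ[F] (E ⊗[F] U)) where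
  toFun x := TensorProduct.congr x.1 x.2
  map_one' := by
    apply LinearEquiv.toLinearMap_injective
    ext; simp
  map_mul' x y := by
    apply LinearEquiv.toLinearMap_injective
    ext; simp

@[simp] theorem Th_tmul (g : E ≃ₗ[F] E) (h : U ≃ₗ[F] U) (f : E) (w : U) : Th (g, h) (f ⊗ₜ[F] w) = g f ⊗ₜ h w := rfl

theorem form [FiniteDimensional F E] [FiniteDimensional F U] (h2 : Module.finrank F U = 2)
    (hlt : Module.finrank F U < Module.finrank F E) (u : (E ⊗[F] U) ≃ₗ[F] (E ⊗[F] U))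
    (hu : ∀ x ∈ R1 F E U, u x ∈ R1 F E U) : ∃ g h, u = Th (g, h) := by
  have : Nontrivial E := (Module.finrank_pos_iff (R := F)).1 (by omega)
  obtain ⟨e, he⟩ := exists_ne (0 : E)
  let b : Module.Basis (Fin 2) F U := Module.finBasisOfFinrankEq F U h2
  obtain ⟨w1, hw1, g1, hg1⟩ := stepA hlt u hu (b 0) (b.ne_zero 0)
  obtain ⟨w2, hw2, g2, hg2⟩ := stepA hlt u hu (b 1) (b.ne_zero 1)
  have hinj : Function.Injective g1 := by
    rw [← LinearMap.ker_eq_bot, LinearMap.ker_eq_bot']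
    intro f hf
    by_contra hf0
    have := hg1 f
    rw [hf] at this
    simp at this
    exact tmul_ne_zero hf0 (b.ne_zero 0) this
  have hind : w1 ∉ Submodule.span F {w2} := by
    intro h
    have hne : Submodule.span F {w2} < ⊤ := by
      rw [lt_top_iff_ne_top]; intro ht
      have := finrank_span_le_card (R := F) ({w2} : Set U)
      rw [ht, finrank_top, h2] at this
      simp at this
    obtain ⟨φ, hφ, hle⟩ := Submodule.exists_le_ker_of_lt_top _ hne
    have e1 : φ w1 = 0 := hle h
    have e2 : φ w2 = 0 := hle (Submodule.mem_span_singleton_self _)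
    have hz : cr (E := E) φ ∘ₗ u.toLinearMap = 0 := by
      apply TensorProduct.ext
      refine LinearMap.ext fun f => b.ext fun i => ?_
      fin_cases i
      · simp [hg1, e1]
      · simp [hg2, e2]
    obtain ⟨v, hv⟩ : ∃ v, φ v ≠ 0 := by
      by_contra hcon; push Not at hcon; exact hφ (LinearMap.ext hcon)
    have h3 := LinearMap.congr_fun hz (u.symm (e ⊗ₜ v))
    simp [hv, he] at h3
  let g := LinearEquiv.ofInjectiveEndo g1 hinj
  have hgg : ∀ f, g f = g1 f := fun f => rfl
  have hk : ∀ f, g2 f ∈ Submodule.span F {g1 f} := by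
    intro f
    by_cases hf : f = 0
    · subst hf; simp
    refine pair_lem hind hw2 (by rw [Ne, map_eq_zero_iff _ hinj]; exact hf) ?_
    right
    rw [← hg1, ← hg2, ← map_add, ← TensorProduct.tmul_add]
    refine hu _ (tmul_mem_R1 hf ?_)
    intro h0
    have h4 := congrArg (b.repr · 0) h0
    simp at h4
  obtain ⟨l, hl⟩ := LinearMap.exists_eq_smul_id_of_forall_notLinearIndependent
    (f := g.symm.toLinearMap ∘ₗ g2) (by
      intro v hv
      obtain ⟨c, hc⟩ := Submodule.mem_span_singleton.1 (hk v)
      have h5 : g.symm (g2 v) = c • v := by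
        rw [← hc, map_smul]; congr 1; rw [← hgg, LinearEquiv.symm_apply_apply]
      have h6 := LinearIndependent.pair_iff.1 hv c (-1) (by simp [h5])
      simp at h6)
  have hl' : ∀ f, g2 f = l • g f := by
    intro f
    have := LinearMap.congr_fun hl f
    simp at this
    rw [LinearEquiv.symm_apply_eq] at this
    rw [this, map_smul]
  let h : U →ₗ[F] U := b.constr F ![w1, l • w2]
  have hfin : ∀ f v, u (f ⊗ₜ v) = g f ⊗ₜ h v := by
    intro f v
    have : u.toLinearMap ∘ₗ TensorProduct.mk F E U f = TensorProduct.mk F E U (g f) ∘ₗ h := by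
      refine b.ext fun i => ?_
      fin_cases i
      · simp [h, hg1, hgg]
      · simp [h, hg2, hl', TensorProduct.smul_tmul]
    exact LinearMap.congr_fun this v
  have hhi : Function.Injective h := by
    rw [← LinearMap.ker_eq_bot, LinearMap.ker_eq_bot']
    intro v hv
    by_contra hv0
    have := hfin e v
    rw [hv] at this
    simp at this
    exact tmul_ne_zero he hv0 this
  refine ⟨g, LinearEquiv.ofInjectiveEndo h hhi, ?_⟩
  apply LinearEquiv.toLinearMap_injective
  apply TensorProduct.ext'
  intro f v
  exact hfin f v

theorem Th_inj (g : E ≃ₗ[F] E) (h : U ≃ₗ[F] U) (H : Th (g, h) = 1) {f : E} {w : U} (hw : w ≠ 0) (hf : f ≠ 0)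
    (hgf : g f = f) : g = 1 ∧ h = 1 := by
  have hh : h = 1 := by
    ext v
    have := LinearEquiv.congr_fun H (f ⊗ₜ v)
    simp [hgf] at this
    have h2 : f ⊗ₜ[F] (h v - v) = 0 := by rw [TensorProduct.tmul_sub, this, sub_self]
    by_contra h3
    exact tmul_ne_zero hf (sub_ne_zero.2 h3) h2
  subst hh
  refine ⟨?_, rfl⟩
  ext v
  have := LinearEquiv.congr_fun H (v ⊗ₜ w)
  simp at this
  have h2 : (g v - v) ⊗ₜ[F] w = 0 := by rw [TensorProduct.sub_tmul, this, sub_self]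
  by_contra h3
  exact tmul_ne_zero (sub_ne_zero.2 h3) hw h2

theorem Th_inj1 (g : E ≃ₗ[F] E) (H : Th (g, (1 : U ≃ₗ[F] U)) = 1) {w : U} (hw : w ≠ 0) : g = 1 := by
  ext v
  have := LinearEquiv.congr_fun H (v ⊗ₜ w)
  simp at this
  have h2 : (g v - v) ⊗ₜ[F] w = 0 := by rw [TensorProduct.sub_tmul, this, sub_self]
  by_contra h3
  exact tmul_ne_zero (sub_ne_zero.2 h3) hw h2

/-- rank-two vectors -/
theorem decomp (b : Module.Basis (Fin 2) F U) (x : E ⊗[F] U) : ∃ a1 a2 : E, x = a1 ⊗ₜ b 0 + a2 ⊗ₜ b 1 := by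
  induction x using TensorProduct.induction_on with
  | zero => exact ⟨0, 0, by simp⟩
  | tmul f v =>
    refine ⟨b.repr v 0 • f, b.repr v 1 • f, ?_⟩
    have h := b.sum_repr v
    rw [Fin.sum_univ_two] at h
    rw [TensorProduct.smul_tmul, TensorProduct.smul_tmul, ← TensorProduct.tmul_add, h]
  | add x y hx hy =>
    obtain ⟨a1, a2, rfl⟩ := hx
    obtain ⟨c1, c2, rfl⟩ := hy
    exact ⟨a1 + c1, a2 + c2, by rw [TensorProduct.add_tmul, TensorProduct.add_tmul]; abel⟩

theorem rank2 (b : Module.Basis (Fin 2) F U) (x : E ⊗[F] U) (hx0 : x ≠ 0) (hx : x ∉ R1 F E U) :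
    ∃ a1 a2 : E, a1 ≠ 0 ∧ a2 ≠ 0 ∧ a1 ∉ Submodule.span F {a2} ∧ x = a1 ⊗ₜ b 0 + a2 ⊗ₜ b 1 := by
  obtain ⟨a1, a2, rfl⟩ := decomp b x
  have hne : ∀ (f : E) (v : U), f ⊗ₜ[F] v = a1 ⊗ₜ b 0 + a2 ⊗ₜ b 1 → False := by
    intro f v h
    by_cases hf : f = 0
    · subst hf; simp at h; exact hx0 h.symm
    by_cases hv : v = 0
    · subst hv; simp at h; exact hx0 h.symm
    exact hx (h ▸ tmul_mem_R1 hf hv)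
  refine ⟨a1, a2, ?_, ?_, ?_, rfl⟩
  · rintro rfl; exact hne a2 (b 1) (by simp)
  · rintro rfl; exact hne a1 (b 0) (by simp)
  · intro h
    obtain ⟨c, rfl⟩ := Submodule.mem_span_singleton.1 h
    exact hne a2 (c • b 0 + b 1) (by rw [TensorProduct.tmul_add, TensorProduct.smul_tmul])

theorem uniq (b : Module.Basis (Fin 2) F U) {a1 a2 c1 c2 : E}
    (h : a1 ⊗ₜ[F] b 0 + a2 ⊗ₜ b 1 = c1 ⊗ₜ[F] b 0 + c2 ⊗ₜ b 1) : a1 = c1 ∧ a2 = c2 := by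
  constructor
  · have := congrArg (cr (b.coord 0)) h
    simpa using this
  · have := congrArg (cr (b.coord 1)) h
    simpa using this

theorem uniq' {a1 a2 : E} (h1 : a1 ∉ Submodule.span F {a2}) (h2 : a2 ≠ 0) {u v u' v' : U}
    (h : a1 ⊗ₜ[F] u + a2 ⊗ₜ v = a1 ⊗ₜ[F] u' + a2 ⊗ₜ v') : u = u' ∧ v = v' := by
  obtain ⟨φ1, h11, h12⟩ := dual_pair h1
  obtain ⟨φ2, h22, h21⟩ := dual_pair (notMem_symm h1 h2)
  constructor
  · have := congrArg (cl φ1) h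
    simpa [h11, h12] using this
  · have := congrArg (cl φ2) h
    simpa [h22, h21] using this

/-- extending a nonzero vector to a basis -/
theorem ext_basis [FiniteDimensional F U] (h2 : Module.finrank F U = 2) (u : U) (hu : u ≠ 0) :
    ∃ b : Module.Basis (Fin 2) F U, b 0 = u := by
  have : ∃ v : U, v ∉ Submodule.span F {u} := by
    by_contra hcon
    push Not at hcon
    have ht : Submodule.span F {u} = ⊤ := by rw [eq_top_iff]; exact fun v _ => hcon v
    have := finrank_span_le_card (R := F) ({u} : Set U)
    rw [ht, finrank_top, h2] at this
    simp at this
  obtain ⟨v, hv⟩ := this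
  have hli : LinearIndependent F ![u, v] := by
    rw [LinearIndependent.pair_iff' hu]
    intro a h
    exact hv (Submodule.mem_span_singleton.2 ⟨a, h⟩)
  exact ⟨basisOfLinearIndependentOfCardEqFinrank hli (by simp [h2]), by simp⟩

theorem z11a : ∀ l : ZMod 11, (l+1)*(l+1)*(l+1) - 1 = 0 → l = 0 := by decide
theorem z11b : (3 : ZMod 11) = 1 + 1 + 1 := by decide
theorem z11c : ¬ (3 : ZMod 11) = 0 := by decide

theorem cube [Fact (Nat.Prime 11)] {E : Type*} [AddCommGroup E] [Module (ZMod 11) E] [FiniteDimensional (ZMod 11) E]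
    (g : E ≃ₗ[ZMod 11] E) (hg : g ^ 3 = 1) (Q : Submodule (ZMod 11) E) (hQ : ∀ x ∈ Q, g x = x)
    (hd : Module.finrank (ZMod 11) E ≤ Module.finrank (ZMod 11) Q + 1) : g = 1 := by
  let N : E →ₗ[ZMod 11] E := g.toLinearMap - LinearMap.id
  have hN : ∀ x, N x = g x - x := fun x => rfl
  have hgN : ∀ x, g x = N x + x := fun x => by rw [hN]; abel
  have hle : Q ≤ LinearMap.ker N := fun x hx => by
    rw [LinearMap.mem_ker, hN, hQ x hx, sub_self]
  have h1 := Submodule.finrank_mono hle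
  have h2 := LinearMap.finrank_range_add_finrank_ker N
  have h3 : Module.finrank (ZMod 11) (LinearMap.range N) ≤ 1 := by omega
  obtain ⟨w, hw⟩ := finrank_le_one_iff.1 h3
  have h3g : ∀ x, g (g (g x)) = x := fun x => by
    have := LinearEquiv.congr_fun hg x
    simpa [pow_succ] using this
  obtain ⟨l, hl⟩ := hw ⟨N w, LinearMap.mem_range_self _ _⟩
  have hl' : N w = l • (w : E) := (congrArg Subtype.val hl).symm
  have hgw : g w = (l + 1) • (w : E) := by rw [hgN, hl', add_smul, one_smul]
  have hNw : N w = 0 := by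
    have h4 := h3g w
    simp only [hgw, map_smul, smul_smul] at h4
    have h5 : ((l+1)*(l+1)*(l+1) - 1) • (w : E) = 0 := by rw [sub_smul, h4, one_smul, sub_self]
    rcases smul_eq_zero.1 h5 with h6 | h6
    · rw [hl', z11a l h6, zero_smul]
    · rw [hl', h6, smul_zero]
  have hNN : ∀ x, N (N x) = 0 := by
    intro x
    obtain ⟨c, hc⟩ := hw ⟨N x, LinearMap.mem_range_self _ _⟩
    have hc' : N x = c • (w : E) := (congrArg Subtype.val hc).symm
    rw [hc', map_smul, hNw, smul_zero]
  ext x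
  have h4 := h3g x
  have e1 : g x = N x + x := hgN x
  have e2 : g (N x) = N x := by rw [hgN, hNN, zero_add]
  simp only [e1, map_add, e2] at h4
  have h5 : (3 : ZMod 11) • N x = 0 := by
    have e3 : (3 : ZMod 11) = 1 + 1 + 1 := z11b
    rw [e3, add_smul, add_smul, one_smul]
    have : N x + (N x + (N x + x)) - x = 0 := by rw [h4, sub_self]
    rw [← this]; abel
  have h6 : N x = 0 := (smul_eq_zero.1 h5).resolve_left z11c
  rw [e1, h6, zero_add]; rfl

/-- no fixed vectors for `g`, `g^7 = 1`, then no small invariant subspaces -/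
theorem no_inv [Fact (Nat.Prime 11)] {E : Type*} [AddCommGroup E] [Module (ZMod 11) E] [Finite E]
    (g : E ≃ₗ[ZMod 11] E) (hg : g ^ 7 = 1) (hfix : ∀ x, g x = x → x = 0)
    (Q : Submodule (ZMod 11) E) (hQ : ∀ x ∈ Q, g x ∈ Q)
    (hd : Module.finrank (ZMod 11) Q = 1 ∨ Module.finrank (ZMod 11) Q = 2) : False := by
  have : Fact (Nat.Prime 7) := ⟨by norm_num⟩
  have : Finite (E ≃ₗ[ZMod 11] E) := DFunLike.finite _
  have hK : IsPGroup 7 (Subgroup.zpowers g) := by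
    intro x
    obtain ⟨n, hn⟩ := Subgroup.mem_zpowers_iff.1 x.2
    refine ⟨1, Subtype.ext ?_⟩
    simp only [pow_one, Subgroup.coe_pow, Subgroup.coe_one, ← hn]
    rw [← zpow_natCast, ← zpow_mul, mul_comm, zpow_mul, zpow_natCast, hg, one_zpow]
  have hcard : ((Q : Set E) \ {0}).ncard = 11 ^ Module.finrank (ZMod 11) Q - 1 := by
    rw [Set.ncard_sdiff_singleton_of_mem Q.zero_mem]
    congr 1
    have := Module.natCard_eq_pow_finrank (K := ZMod 11) (V := Q)
    rw [Nat.card_zmod] at this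
    exact this
  obtain ⟨x, hx, h⟩ := Ga.fixed 7 (Subgroup.zpowers g) hK ((Q : Set E) \ {0}) (by
      intro y hy x hx
      obtain ⟨n, rfl⟩ := (mem_powers_iff_mem_zpowers.2 hy)
      have hpow : ∀ n : ℕ, (g^n) x ∈ Q := by
        intro n
        induction n with
        | zero => exact hx.1
        | succ n ih => rw [pow_succ']; exact hQ _ ih
      refine ⟨hpow n, fun h => hx.2 ?_⟩
      exact (map_eq_zero_iff (g^n) (g^n).injective).1 h)
    (by rw [hcard]; rcases hd with h | h <;> rw [h] <;> norm_num)
  exact hx.2 (hfix x (h g (Subgroup.mem_zpowers g)))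
end Tn

namespace Pc
open Pointwise
open Tn MulAction

section sumlem
variable {F V : Type*} [Field F] [AddCommGroup V] [Module F V] [Finite V]
open Classical in
/-- sum of all elements of a finite set -/
noncomputable def sm (B : Set V) : V := ∑ x ∈ B.toFinite.toFinset, x

theorem sm_image (g : V ≃ₗ[F] V) (v : V) (B : Set V) :
    sm ((fun x => g x + v) '' B) = g (sm B) + B.ncard • v := by
  classical
  unfold sm
  have hi : Function.Injective (fun x => g x + v) := fun a b h => by simpa using h
  have : ((fun x => g x + v) '' B).toFinite.toFinset = B.toFinite.toFinset.image (fun x => g x + v) := by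
    ext; simp
  rw [this, Finset.sum_image (fun a _ b _ h => hi h), Finset.sum_add_distrib, map_sum, Finset.sum_const,
    Set.ncard_eq_toFinset_card B]
end sumlem

theorem z112 {V : Type*} [AddCommGroup V] [Module (ZMod 11) V] (v : V) : (112:ℕ) • v = (2 : ZMod 11) • v := by
  rw [← Nat.cast_smul_eq_nsmul (ZMod 11)]; congr 1

theorem z2 : (2 : ZMod 11) * 6 = 1 := by decide

theorem z2v {V : Type*} [AddCommGroup V] [Module (ZMod 11) V] (v : V) (h : (112:ℕ) • v = 0) : v = 0 := by
  rw [z112] at h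
  have := congrArg (fun w => (6 : ZMod 11) • w) h
  simp only [smul_smul, smul_zero] at this
  rwa [mul_comm, z2, one_smul] at this

section des
variable [Fact (Nat.Prime 11)] {V : Type*} [AddCommGroup V] [Module (ZMod 11) V] [Finite V] {𝓑 : Set (Set V)}
  {G₀ : Subgroup (V ≃ₗ[ZMod 11] V)}

theorem finW : Finite (V ≃ₗ[ZMod 11] V) := DFunLike.finite _

theorem div_orb (D : Dsg 𝓑 112 31920 G₀) (x : V) (hx : x ≠ 0) :
    15960 ∣ (stabilizer (V ≃ₗ[ZMod 11] V) x).relIndex G₀ := by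
  have := finW (V := V)
  rw [← Ga.ncard_orbit]
  obtain ⟨n, -, hn⟩ := D.orbit_count (orbit G₀ x) (by
      rintro ⟨g, hg⟩
      have hg' : (g : V ≃ₗ[ZMod 11] V) x = 0 := hg
      exact hx ((map_eq_zero_iff _ (LinearEquiv.injective _)).1 hg')) (by
      rintro g hg y ⟨h, rfl⟩
      exact ⟨⟨g, hg⟩ * h, mul_smul _ _ _⟩)
  exact ⟨n, by omega⟩

theorem block (D : Dsg 𝓑 112 31920 G₀) (hV : Nat.card V = 11^6) :
    ∃ B ∈ 𝓑, (∀ x ∈ B, ∀ y ∈ B, ∃ g ∈ stabilizer (V ≃ₗ[ZMod 11] V) B ⊓ G₀, g x = y) ∧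
      (stabilizer (V ≃ₗ[ZMod 11] V) B ⊓ G₀).relIndex G₀ = 285 := by
  have hone : ∀ v : V, (fun x : V => x + v) = (fun x => (1 : V ≃ₗ[ZMod 11] V) x + v) := fun v => rfl
  have hshift : ∀ (B : Set V), B ∈ 𝓑 → ∀ v : V, sm ((fun x => x + v) '' B) = sm B + (112:ℕ) • v := by
    intro B hB v
    have h := sm_image (1 : V ≃ₗ[ZMod 11] V) v B
    rw [D.hk B hB] at h
    exact h
  let C0 : Set (Set V) := {B ∈ 𝓑 | sm B = 0}
  have hc : ∀ B ∈ 𝓑, ∃ v : V, (fun x => x + v) '' B ∈ C0 := by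
    intro B hB
    refine ⟨(-6 : ZMod 11) • sm B, D.trans_mem hB _, ?_⟩
    rw [hshift B hB, z112, smul_smul]
    have : (2 : ZMod 11) * (-6) = -1 := by rw [mul_neg, z2]
    rw [this, neg_smul, one_smul, add_neg_cancel]
  obtain ⟨B₀, hB₀, -⟩ := D.exists_block 0
  obtain ⟨v₀, hB⟩ := hc B₀ hB₀
  generalize (fun x => x + v₀) '' B₀ = B at hB
  have hfl : ∀ C ∈ C0, ∀ x ∈ B, ∀ y ∈ C, ∃ g ∈ G₀, g '' B = C ∧ g x = y := by
    intro C hC x hx y hy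
    obtain ⟨g, hg, v, h1, h2⟩ := D.hflag B hB.1 C hC.1 x hx y hy
    have h3 := sm_image g v B
    rw [h1, hC.2, hB.2, map_zero, zero_add, D.hk B hB.1] at h3
    have hv := z2v v h3.symm
    subst hv
    simp only [add_zero] at h1 h2
    exact ⟨g, hg, h1, h2⟩
  have hne : ∀ C ∈ 𝓑, C.Nonempty := by
    intro C hC
    rw [← Set.ncard_pos, D.hk C hC]; norm_num
  refine ⟨B, hB.1, ?_, ?_⟩
  · intro x hx y hy
    obtain ⟨g, hg, h1, h2⟩ := hfl B hB x hx y hy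
    exact ⟨g, ⟨h1, hg⟩, h2⟩
  · rw [Subgroup.inf_relIndex_right]
    have := finW (V := V)
    rw [← Ga.ncard_orbit]
    have horb : orbit G₀ B = C0 := by
      ext C
      constructor
      · rintro ⟨g, rfl⟩
        refine ⟨D.map_mem hB.1 g.2, ?_⟩
        have h := sm_image (g : V ≃ₗ[ZMod 11] V) 0 B
        simp only [add_zero, smul_zero, hB.2, map_zero] at h
        exact h
      · intro hC
        obtain ⟨x, hx⟩ := hne B hB.1
        obtain ⟨y, hy⟩ := hne C hC.1
        obtain ⟨g, hg, h1, -⟩ := hfl C hC x hx y hy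
        exact ⟨⟨g, hg⟩, h1⟩
    rw [horb]
    have hcount : 𝓑.ncard = C0.ncard * Nat.card V := by
      have h1 : 𝓑 = (fun q : Set V × V => (fun x => x + q.2) '' q.1) '' (C0 ×ˢ Set.univ) := by
        ext C
        constructor
        · intro hC
          obtain ⟨v, hv⟩ := hc C hC
          refine ⟨(_, -v), ⟨hv, trivial⟩, ?_⟩
          change (fun x => x + -v) '' ((fun x => x + v) '' C) = C
          rw [Set.image_image]; simp only [add_neg_cancel_right, Set.image_id']
        · rintro ⟨⟨C', v⟩, ⟨hC', -⟩, rfl⟩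
          exact D.trans_mem hC'.1 v
      rw [h1, Set.ncard_image_of_injOn, Set.ncard_prod, Set.ncard_univ]
      rintro ⟨C, v⟩ ⟨hC, -⟩ ⟨C', v'⟩ ⟨hC', -⟩ h
      simp only at h hC hC'
      have h2 := congrArg sm h
      rw [hshift C hC.1, hshift C' hC'.1, hC.2, hC'.2, zero_add, zero_add] at h2
      have h3 : v - v' = 0 := z2v _ (by rw [smul_sub, h2, sub_self])
      obtain rfl := sub_eq_zero.1 h3
      have h4 := (Set.image_injective.2 (add_left_injective v)) h
      rw [h4]
    have h5 := D.bk
    rw [hcount, hV] at h5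
    norm_num at h5
    omega
end des
end Pc

namespace Pc
open Pointwise
open Tn MulAction

theorem card_rel {G : Type*} [Group G] (H K : Subgroup G) (h : H ≤ K) : Nat.card H * H.relIndex K = Nat.card K := by
  have := Subgroup.relIndex_mul_relIndex ⊥ H K bot_le h
  rwa [Subgroup.relIndex_bot_left, Subgroup.relIndex_bot_left] at this

theorem cardGL [Fact (Nat.Prime 11)] (E : Type*) [AddCommGroup E] [Module (ZMod 11) E] [Finite E] (n : ℕ)
    (h : Module.finrank (ZMod 11) E = n) :
    Nat.card (E ≃ₗ[ZMod 11] E) = ∏ i : Fin n, (11 ^ n - 11 ^ (i:ℕ)) := by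
  let b := Module.finBasisOfFinrankEq (ZMod 11) E h
  let e : (E ≃ₗ[ZMod 11] E) ≃* Matrix.GeneralLinearGroup (Fin n) (ZMod 11) :=
    (LinearMap.GeneralLinearGroup.generalLinearEquiv (ZMod 11) E).symm.trans
      (Units.mapEquiv (LinearMap.toMatrixAlgEquiv b).toMulEquiv)
  rw [Nat.card_congr e.toEquiv, Matrix.card_GL_field, ZMod.card]

theorem det10 : ∀ d : ZMod 11, d ^ 7 = 1 → d = 1 := by decide

theorem det2 : ∀ d : ZMod 11, d = -d → d = 0 := by decide

section
set_option linter.unusedSectionVars false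
variable [Fact (Nat.Prime 11)] {E U : Type*} [AddCommGroup E] [Module (ZMod 11) E] [Finite E]
  [AddCommGroup U] [Module (ZMod 11) U] [Finite U] [Finite (E ⊗[ZMod 11] U)]
  {G₀ : Subgroup ((E ⊗[ZMod 11] U) ≃ₗ[ZMod 11] (E ⊗[ZMod 11] U))}

theorem not49 (h3 : Module.finrank (ZMod 11) E = 3) (h2 : Module.finrank (ZMod 11) U = 2)
    (hG : ∀ u ∈ G₀, ∃ g h, u = Th (g, h)) : ¬ 49 ∣ Nat.card G₀ := by
  intro h
  have hle : G₀ ≤ Th.range := by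
    intro u hu
    obtain ⟨g, h, rfl⟩ := hG u hu
    exact ⟨(g, h), rfl⟩
  have h4 := (h.trans (Subgroup.card_dvd_of_le hle)).trans (Subgroup.card_range_dvd _)
  rw [Nat.card_prod, cardGL E 3 h3, cardGL U 2 h2] at h4
  simp [Fin.prod_univ_succ] at h4

theorem cardU (h2 : Module.finrank (ZMod 11) U = 2) (h : U ≃ₗ[ZMod 11] U) : h ^ 13200 = 1 := by
  have := cardGL U 2 h2
  simp [Fin.prod_univ_succ] at this
  rw [← this]
  exact pow_card_eq_one'

theorem nofix {𝓑 : Set (Set (E ⊗[ZMod 11] U))} (D : Dsg 𝓑 112 31920 G₀) (h49 : ¬ 49 ∣ Nat.card G₀)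
    (z : (E ⊗[ZMod 11] U) ≃ₗ[ZMod 11] (E ⊗[ZMod 11] U)) (hz : z ∈ G₀) (hz7 : orderOf z = 7)
    (x : E ⊗[ZMod 11] U) (hx : z x = x) : x = 0 := by
  by_contra h0
  have := finW (V := E ⊗[ZMod 11] U)
  have hle : Subgroup.zpowers z ≤ G₀ := by rw [Subgroup.zpowers_le]; exact hz
  have hc := card_rel _ _ hle
  rw [Nat.card_zpowers, hz7] at hc
  have h1 := Ga.dvd_sub (Subgroup.zpowers z) G₀ hle 7 x ((by norm_num : 7 ∣ 15960).trans (div_orb D x h0)) (by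
    rw [(by norm_num : Nat.Prime 7).coprime_iff_not_dvd]
    rintro ⟨m, hm⟩
    exact h49 ⟨m, by rw [← hc, hm]; ring⟩)
  have h2 : (stabilizer _ x).relIndex (Subgroup.zpowers z) = 1 := by
    rw [Subgroup.relIndex_eq_one, Subgroup.zpowers_le]; exact hx
  rw [h2] at h1
  norm_num at h1

theorem seven (h2 : Module.finrank (ZMod 11) U = 2) (hG : ∀ u ∈ G₀, ∃ g h, u = Th (g, h))
    (hnf : ∀ z ∈ G₀, orderOf z = 7 → ∀ x, z x = x → x = 0)
    (z : (E ⊗[ZMod 11] U) ≃ₗ[ZMod 11] (E ⊗[ZMod 11] U)) (hz : z ∈ G₀) (hz7 : orderOf z = 7) :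
    ∃ g : E ≃ₗ[ZMod 11] E, Th (g, (1 : U ≃ₗ[ZMod 11] U)) = z ^ 13200 ∧ orderOf (Th (g, (1 : U ≃ₗ[ZMod 11] U))) = 7 ∧
      g ^ 7 = 1 ∧ ∀ f, g f = f → f = 0 := by
  have : Nontrivial U := (Module.finrank_pos_iff (R := ZMod 11)).1 (by omega)
  obtain ⟨u, hu⟩ := exists_ne (0 : U)
  obtain ⟨g, h, rfl⟩ := hG z hz
  have e : Th (g ^ 13200, (1 : U ≃ₗ[ZMod 11] U)) = Th (g, h) ^ 13200 := by
    rw [← map_pow, Prod.pow_mk, cardU h2 h]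
  have ho : orderOf (Th (g ^ 13200, (1 : U ≃ₗ[ZMod 11] U))) = 7 := by
    rw [e, Nat.Coprime.orderOf_pow, hz7]
    rw [hz7]; norm_num
  refine ⟨g ^ 13200, e, ho, ?_, ?_⟩
  · apply Th_inj1 _ _ hu
    have := pow_orderOf_eq_one (Th (g ^ 13200, (1 : U ≃ₗ[ZMod 11] U)))
    rw [ho, ← map_pow, Prod.pow_mk, one_pow] at this
    exact this
  · intro f hf
    by_contra hf0
    have h5 := hnf (Th (g ^ 13200, (1 : U ≃ₗ[ZMod 11] U))) (by rw [e]; exact G₀.pow_mem hz _) ho (f ⊗ₜ u)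
      (by rw [Th_tmul, hf]; rfl)
    exact tmul_ne_zero hf0 hu h5

theorem noinv (h3 : Module.finrank (ZMod 11) E = 3) (g a : E ≃ₗ[ZMod 11] E) (hg : g ^ 7 = 1)
    (hf : ∀ f, g f = f → f = 0) (h : a * g * a⁻¹ = g⁻¹) : False := by
  let L : E →ₗ[ZMod 11] E := LinearMap.id - g.toLinearMap
  have hdg : LinearMap.det g.toLinearMap = 1 := by
    apply det10
    rw [← map_pow]
    have : g.toLinearMap ^ 7 = LinearMap.id := by
      ext x
      have := LinearEquiv.congr_fun hg x
      simpa [pow_succ] using this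
    rw [this, LinearMap.det_id]
  have hcomp : g.toLinearMap ∘ₗ (a.toLinearMap ∘ₗ L ∘ₗ a.symm.toLinearMap) = (-1 : ZMod 11) • L := by
    ext x
    have h5 := LinearEquiv.congr_fun h x
    have h6 : a (g (a.symm x)) = g.symm x := h5
    simp [L, h6]
  have hd := congrArg LinearMap.det hcomp
  rw [LinearMap.det_comp, hdg, one_mul, LinearMap.det_smul, h3] at hd
  have h7 : LinearMap.det (a.toLinearMap ∘ₗ L ∘ₗ a.symm.toLinearMap) = LinearMap.det L := LinearMap.det_conj L a
  rw [h7] at hd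
  have h8 : LinearMap.det L = 0 := det2 _ (hd.trans (by ring))
  have h9 : LinearMap.ker L = ⊥ := by
    rw [LinearMap.ker_eq_bot']
    intro f hf'
    apply hf
    have : f - g f = 0 := hf'
    exact (sub_eq_zero.1 this).symm
  have : IsUnit (LinearMap.det L) := by
    rw [← LinearMap.isUnit_iff_isUnit_det, LinearMap.isUnit_iff_ker_eq_bot]; exact h9
  rw [h8] at this
  exact not_isUnit_zero this
end
end Pc

namespace Pc
open Pointwise
open Tn MulAction
section
set_option linter.unusedSectionVars false
variable [Fact (Nat.Prime 11)] {E U : Type*} [AddCommGroup E] [Module (ZMod 11) E] [Finite E]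
  [AddCommGroup U] [Module (ZMod 11) U] [Finite U] [Finite (E ⊗[ZMod 11] U)]
  {G₀ : Subgroup ((E ⊗[ZMod 11] U) ≃ₗ[ZMod 11] (E ⊗[ZMod 11] U))}

theorem scale (g : E ≃ₗ[ZMod 11] E) (h : U ≃ₗ[ZMod 11] U) (c : ZMod 11) (hc : c ≠ 0) :
    ∃ g' h', Th (g', h') = Th (g, h) ∧ (∀ x, g' x = c⁻¹ • g x) ∧ (∀ x, h' x = c • h x) := by
  refine ⟨g.trans (LinearEquiv.smulOfNeZero (ZMod 11) E c⁻¹ (inv_ne_zero hc)),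
    h.trans (LinearEquiv.smulOfNeZero (ZMod 11) U c hc), ?_, fun x => rfl, fun x => rfl⟩
  apply LinearEquiv.toLinearMap_injective
  apply TensorProduct.ext'
  intro f v
  change (c⁻¹ • g f) ⊗ₜ[ZMod 11] (c • h v) = g f ⊗ₜ h v
  rw [TensorProduct.smul_tmul, smul_smul, inv_mul_cancel₀ hc, one_smul]

theorem normal (g : E ≃ₗ[ZMod 11] E) (h : U ≃ₗ[ZMod 11] U) (f : E) (u : U) (hf : f ≠ 0) (hu : u ≠ 0)
    (H : Th (g, h) (f ⊗ₜ u) = f ⊗ₜ u) :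
    ∃ g' h', Th (g', h') = Th (g, h) ∧ g' f = f ∧ h' u = u := by
  obtain ⟨c, hc, h1, h2⟩ := tmul_eq hf hu H.symm
  obtain ⟨g', h', e, e1, e2⟩ := scale g h c hc
  refine ⟨g', h', e, ?_, ?_⟩
  · rw [e1]
    change g f = _ at h1
    rw [h1, smul_smul, inv_mul_cancel₀ hc, one_smul]
  · rw [e2]
    change h u = _ at h2
    rw [h2, smul_smul, mul_inv_cancel₀ hc, one_smul]

theorem pgrp {G : Type*} [Group G] (q : ℕ) (t : G) (h : orderOf t = q) : IsPGroup q (Subgroup.zpowers t) := by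
  intro x
  obtain ⟨n, hn⟩ := Subgroup.mem_zpowers_iff.1 x.2
  refine ⟨1, Subtype.ext ?_⟩
  simp only [pow_one, Subgroup.coe_pow, Subgroup.coe_one, ← hn]
  rw [← zpow_natCast, ← zpow_mul, mul_comm, zpow_mul, zpow_natCast, ← h, pow_orderOf_eq_one, one_zpow]

theorem three (h3 : Module.finrank (ZMod 11) E = 3) (h2 : Module.finrank (ZMod 11) U = 2)
    (B : Set (E ⊗[ZMod 11] U)) (hB0 : 0 ∉ B) (hBR : ∀ x ∈ B, x ∉ R1 (ZMod 11) E U) (hBc : ¬ 3 ∣ B.ncard)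
    (part : ∀ x ∈ B, ∃ x' ∈ B, x' - x ∈ R1 (ZMod 11) E U ∧ ∀ y ∈ B, y - x ∈ R1 (ZMod 11) E U → y = x')
    (g : E ≃ₗ[ZMod 11] E) (h : U ≃ₗ[ZMod 11] U) (htB : ∀ x ∈ B, Th (g, h) x ∈ B)
    (hR : ∀ x ∈ R1 (ZMod 11) E U, Th (g, h) x ∈ R1 (ZMod 11) E U) (ht : orderOf (Th (g, h)) = 3) : False := by
  have : Fact (Nat.Prime 3) := ⟨by norm_num⟩
  have := finW (V := E ⊗[ZMod 11] U)
  obtain ⟨x, hx, hfx⟩ := Ga.fixed 3 _ (pgrp 3 _ ht) B (by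
    intro y hy x hx
    obtain ⟨n, rfl⟩ := (mem_powers_iff_mem_zpowers.2 hy)
    have hpow : ∀ n : ℕ, ((Th (g, h))^n) x ∈ B := by
      intro n
      induction n with
      | zero => exact hx
      | succ n ih => rw [pow_succ']; exact htB _ ih
    exact hpow n) hBc
  have hfx' : Th (g, h) x = x := hfx _ (Subgroup.mem_zpowers _)
  obtain ⟨x', hx', hxR, huniq⟩ := part x hx
  have hx'f : Th (g, h) x' = x' := by
    apply huniq _ (htB _ hx')
    have := hR _ hxR
    rwa [map_sub, hfx'] at this
  obtain ⟨f, hf, u, hu, hfu⟩ := hxR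
  obtain ⟨g', h', e, e1, e2⟩ := normal g h f u hf hu (by rw [hfu, map_sub, hfx', hx'f])
  rw [← e] at ht hfx'
  have h3' : Th (g'^3, h'^3) = 1 := by
    have := pow_orderOf_eq_one (Th (g', h'))
    rwa [ht, ← map_pow, Prod.pow_mk] at this
  obtain ⟨hg3, hh3⟩ := Th_inj _ _ h3' hu hf (by simp [pow_succ, e1])
  have hh1 : h' = 1 := by
    apply cube h' hh3 (Submodule.span _ {u})
    · intro v hv
      obtain ⟨c, rfl⟩ := Submodule.mem_span_singleton.1 hv
      rw [map_smul, e2]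
    · rw [finrank_span_singleton hu, h2]
  subst hh1
  obtain ⟨b, -⟩ := ext_basis h2 u hu
  obtain ⟨a1, a2, ha1, ha2, hind, rfl⟩ := rank2 b x (fun h => hB0 (h ▸ hx)) (hBR x hx)
  rw [map_add, Th_tmul, Th_tmul] at hfx'
  obtain ⟨k1, k2⟩ := uniq b hfx'
  have hg1 : g' = 1 := by
    apply cube g' hg3 (Submodule.span _ {a1, a2})
    · intro v hv
      obtain ⟨c, d, rfl⟩ := Submodule.mem_span_pair.1 hv
      rw [map_add, map_smul, map_smul, k1, k2]
    · rw [h3]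
      have hli : LinearIndependent (ZMod 11) ![a2, a1] := by
        rw [LinearIndependent.pair_iff' ha2]
        intro a h
        exact hind (Submodule.mem_span_singleton.2 ⟨a, h⟩)
      have := finrank_span_eq_card hli
      have e : Set.range ![a2, a1] = {a2, a1} := by
        simp only [Matrix.range_cons, Matrix.range_empty, Set.union_empty, Set.singleton_union]
      rw [e, Fintype.card_fin] at this
      rw [Set.pair_comm, this]
  subst hg1
  rw [show Th ((1 : E ≃ₗ[ZMod 11] E), (1 : U ≃ₗ[ZMod 11] U)) = 1 from map_one Th, orderOf_one] at ht
  norm_num at ht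

theorem fact1 (g : E ≃ₗ[ZMod 11] E) (hg : g ^ 7 = 1) (hfix : ∀ f, g f = f → f = 0) (f : E) (hf : f ≠ 0) :
    f ∉ Submodule.span (ZMod 11) {g f, g (g f)} := by
  intro h
  have hg' : (g⁻¹)^7 = 1 := by rw [inv_pow, hg, inv_one]
  have hi : ∀ x, g⁻¹ (g x) = x := fun x => g.symm_apply_apply x
  refine no_inv g⁻¹ hg' ?_ (Submodule.span (ZMod 11) {g f, g (g f)}) ?_ ?_
  · intro x hx
    apply hfix
    conv_lhs => rw [← hx]
    exact g.apply_symm_apply x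
  · intro x hx
    obtain ⟨c, d, rfl⟩ := Submodule.mem_span_pair.1 hx
    rw [map_add, map_smul, map_smul, hi, hi]
    exact Submodule.add_mem _ (Submodule.smul_mem _ _ h)
      (Submodule.smul_mem _ _ (Submodule.subset_span (by simp)))
  · have hgf : g f ≠ 0 := by rwa [Ne, map_eq_zero_iff _ g.injective]
    have h1 : Module.finrank (ZMod 11) (Submodule.span (ZMod 11) ({g f, g (g f)} : Set E)) ≤ 2 := by
      classical
      have := finrank_span_finset_le_card (R := ZMod 11) ({g f, g (g f)} : Finset E)
      have h2 := Finset.card_le_two (a := g f) (b := g (g f))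
      simp only [Finset.coe_insert, Finset.coe_singleton] at this
      exact this.trans h2
    have h2 : 1 ≤ Module.finrank (ZMod 11) (Submodule.span (ZMod 11) ({g f, g (g f)} : Set E)) := by
      rw [← finrank_span_singleton (K := ZMod 11) hgf]
      exact Submodule.finrank_mono (Submodule.span_mono (by simp))
    omega

theorem scalar (h3 : Module.finrank (ZMod 11) E = 3) (g a : E ≃ₗ[ZMod 11] E) (hg : g ^ 7 = 1)
    (hfix : ∀ f, g f = f → f = 0) (f : E) (hf : f ≠ 0) (h : ∀ i : ℕ, ∃ μ : ZMod 11, a ((g^i) f) = μ • (g^i) f) :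
    ∃ μ : ZMod 11, ∀ x, a x = μ • x := by
  choose μ hμ using h
  have hs : ∀ i, (g^(i+1)) f = g ((g^i) f) := fun i => by rw [pow_succ']; rfl
  have hne : ∀ i, (g^i) f ≠ 0 := fun i => by rwa [Ne, map_eq_zero_iff _ (g^i).injective]
  have hf1 : ∀ i, (g^i) f ∉ Submodule.span (ZMod 11) {(g^(i+1)) f, (g^(i+2)) f} := by
    intro i
    have := fact1 g hg hfix _ (hne i)
    rwa [← hs, ← hs] at this
  have h7 : ∀ i, (g^(i+7)) f = (g^i) f := fun i => by rw [pow_add, hg, mul_one]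
  have hμ7 : ∀ i, μ (i+7) = μ i := by
    intro i
    have h1 := hμ (i+7)
    rw [h7, hμ i] at h1
    exact (smul_left_injective _ (hne i) h1).symm
  have hspan : Submodule.span (ZMod 11) {(g^0) f, (g^1) f, (g^2) f} = ⊤ := by
    have hli : LinearIndependent (ZMod 11) ![(g^0) f, (g^1) f, (g^2) f] := by
      have h12 : LinearIndependent (ZMod 11) ![(g^1) f, (g^2) f] := by
        refine (LinearIndependent.pair_iff' (hne 1)).2 fun c hc => ?_
        have hc0 : c ≠ 0 := by rintro rfl; rw [zero_smul] at hc; exact hne 2 hc.symm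
        apply hf1 1
        refine Submodule.mem_span_pair.2 ⟨c⁻¹, 0, ?_⟩
        rw [zero_smul, add_zero, ← hc, smul_smul, inv_mul_cancel₀ hc0, one_smul]
      have := linearIndependent_finCons (K := ZMod 11) (x := (g^0) f) (v := ![(g^1) f, (g^2) f])
      refine this.2 ⟨h12, ?_⟩
      have e : Set.range ![(g^1) f, (g^2) f] = {(g^1) f, (g^2) f} := by
        simp only [Matrix.range_cons, Matrix.range_empty, Set.union_empty, Set.singleton_union]
      rw [e]; exact hf1 0
    have := hli.span_eq_top_of_card_eq_finrank (by simp [h3])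
    rw [← this]
    congr 1
    simp only [Matrix.range_cons, Matrix.range_empty, Set.union_empty, Set.singleton_union]
  obtain ⟨α, β, γ, hrel⟩ := Submodule.mem_span_triple.1 (show (g^3) f ∈ Submodule.span (ZMod 11) {(g^0) f, (g^1) f, (g^2) f} from
    hspan ▸ Submodule.mem_top)
  have hα : α ≠ 0 := by
    rintro rfl
    have hg' : (g⁻¹)^7 = 1 := by rw [inv_pow, hg, inv_one]
    have hi : ∀ x, g⁻¹ (g x) = x := fun x => g.symm_apply_apply x
    have := fact1 g⁻¹ hg' (by
      intro x hx
      apply hfix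
      conv_lhs => rw [← hx]
      exact g.apply_symm_apply x) _ (hne 3)
    rw [hs 2, hi, hs 1, hi, ← hs 1, ← hs 2] at this
    apply this
    rw [← hrel]
    refine Submodule.mem_span_pair.2 ⟨γ, β, ?_⟩
    rw [zero_smul, zero_add, add_comm]
  have hreli : ∀ i, (g^(i+3)) f = α • (g^i) f + β • (g^(i+1)) f + γ • (g^(i+2)) f := by
    intro i
    rw [pow_add, LinearEquiv.mul_apply, ← hrel, map_add, map_add, map_smul, map_smul, map_smul]
    simp only [← LinearEquiv.mul_apply, ← pow_add, add_zero]
  have hμ3 : ∀ i, μ (i+3) = μ i := by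
    intro i
    have h1 := hμ (i+3)
    rw [hreli, map_add, map_add, map_smul, map_smul, map_smul, hμ, hμ, hμ] at h1
    by_contra hne'
    apply hf1 i
    have hd : α * (μ (i+3) - μ i) ≠ 0 := mul_ne_zero hα (sub_ne_zero.2 hne')
    have h4 : (α * (μ (i+3) - μ i)) • (g^i) f =
        (β * (μ (i+1) - μ (i+3))) • (g^(i+1)) f + (γ * (μ (i+2) - μ (i+3))) • (g^(i+2)) f := by
      have h5 := sub_eq_zero.2 h1
      rw [← sub_eq_zero, ← neg_eq_zero, ← h5]
      module
    refine Submodule.mem_span_pair.2 ⟨(α * (μ (i+3) - μ i))⁻¹ * (β * (μ (i+1) - μ (i+3))),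
      (α * (μ (i+3) - μ i))⁻¹ * (γ * (μ (i+2) - μ (i+3))), ?_⟩
    rw [mul_smul _ (β * _), mul_smul _ (γ * _), ← smul_add, ← h4, smul_smul, inv_mul_cancel₀ hd, one_smul]
  refine ⟨μ 0, fun x => ?_⟩
  have e2 : μ 2 = μ 0 := by
    have a1 := hμ3 0; have a2 := hμ3 3; have a3 := hμ3 6; have a4 := hμ7 2
    norm_num at a1 a2 a3 a4
    rw [← a4, a3, a2, a1]
  have e1 : μ 1 = μ 0 := by
    have a1 := hμ3 1; have a2 := hμ3 4; have a4 := hμ7 0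
    norm_num at a1 a2 a4
    rw [← a1, ← a2, a4]
  obtain ⟨c0, c1, c2, rfl⟩ := Submodule.mem_span_triple.1 (show x ∈ Submodule.span (ZMod 11) {(g^0) f, (g^1) f, (g^2) f} from
    hspan ▸ Submodule.mem_top)
  rw [map_add, map_add, map_smul, map_smul, map_smul, hμ, hμ, hμ, e1, e2]
  module
end
end Pc

namespace Pc
open Pointwise
open Tn MulAction
section
set_option linter.unusedSectionVars false
variable [Fact (Nat.Prime 11)] {E U : Type*} [AddCommGroup E] [Module (ZMod 11) E] [Finite E]
  [AddCommGroup U] [Module (ZMod 11) U] [Finite U] [Finite (E ⊗[ZMod 11] U)]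
  {G₀ : Subgroup ((E ⊗[ZMod 11] U) ≃ₗ[ZMod 11] (E ⊗[ZMod 11] U))}

/-- the nonzero pure tensors with fixed left factor -/
def Ln (f : E) : Set (E ⊗[ZMod 11] U) := (fun u => f ⊗ₜ[ZMod 11] u) '' {u : U | u ≠ 0}

theorem Ln_sub (f : E) (c : ZMod 11) (hc : c ≠ 0) : Ln (U := U) (c • f) ⊆ Ln f := by
  rintro _ ⟨u, hu, rfl⟩
  refine ⟨c • u, ?_, ?_⟩
  · exact smul_ne_zero hc hu
  · change f ⊗ₜ (c • u) = (c • f) ⊗ₜ[ZMod 11] u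
    rw [TensorProduct.smul_tmul]

theorem Ln_smul (f : E) (c : ZMod 11) (hc : c ≠ 0) : Ln (U := U) (c • f) = Ln f := by
  apply le_antisymm (Ln_sub f c hc)
  have := Ln_sub (U := U) (c • f) c⁻¹ (inv_ne_zero hc)
  rwa [smul_smul, inv_mul_cancel₀ hc, one_smul] at this

theorem Ln_mem {f f' : E} (hf : f ≠ 0) {u : U} (hu : u ≠ 0) (h : f' ⊗ₜ[ZMod 11] u ∈ Ln (U := U) f) :
    ∃ c : ZMod 11, c ≠ 0 ∧ f' = c • f := by
  obtain ⟨u', hu', h⟩ := h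
  obtain ⟨c, hc, h1, -⟩ := tmul_eq hf hu' h
  exact ⟨c, hc, h1⟩

theorem cardnz (h2 : Module.finrank (ZMod 11) U = 2) : {u : U | u ≠ 0}.ncard = 120 := by
  have hU := Module.natCard_eq_pow_finrank (K := ZMod 11) (V := U)
  rw [h2, Nat.card_zmod] at hU
  have : {x : U | x ≠ 0} = {0}ᶜ := by ext; simp
  rw [this, Set.ncard_compl, hU]; simp

theorem Ln_card (h2 : Module.finrank (ZMod 11) U = 2) (f : E) (hf : f ≠ 0) : (Ln (U := U) f).ncard = 120 := by
  rw [Ln, Set.ncard_image_of_injective, cardnz h2]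
  intro u v h
  by_contra hne
  have h2 : f ⊗ₜ[ZMod 11] (u - v) = 0 := by rw [TensorProduct.tmul_sub, sub_eq_zero]; exact h
  exact tmul_ne_zero hf (sub_ne_zero.2 hne) h2

theorem R1c (h3 : Module.finrank (ZMod 11) E = 3) (h2 : Module.finrank (ZMod 11) U = 2) :
    (R1 (ZMod 11) E U).ncard = 15960 := by
  have hU := Module.natCard_eq_pow_finrank (K := ZMod 11) (V := U)
  have hE := Module.natCard_eq_pow_finrank (K := ZMod 11) (V := E)
  have := card_R1 (F := ZMod 11) (E := E) (U := U)
  rw [hU, hE, h2, h3, Nat.card_zmod] at this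
  norm_num at this
  omega

theorem Ln_count (h3 : Module.finrank (ZMod 11) E = 3) (h2 : Module.finrank (ZMod 11) U = 2) :
    (Ln (U := U) '' {f : E | f ≠ 0}).ncard = 133 := by
  have := dcount (fun (L : Set (E ⊗[ZMod 11] U)) (y : E ⊗[ZMod 11] U) => y ∈ L) (Ln (U := U) '' {f : E | f ≠ 0})
    (R1 (ZMod 11) E U) 120 1 ?_ ?_
  · rw [R1c h3 h2] at this; omega
  · rintro _ ⟨f, hf, rfl⟩
    rw [← Ln_card (U := U) h2 f hf]
    congr 1
    ext y
    constructor
    · exact fun h => h.2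
    · rintro ⟨u, hu, rfl⟩
      exact ⟨tmul_mem_R1 hf hu, ⟨u, hu, rfl⟩⟩
  · rintro _ ⟨f, hf, u, hu, rfl⟩
    rw [Set.ncard_eq_one]
    refine ⟨Ln f, ?_⟩
    ext L
    constructor
    · rintro ⟨⟨f', hf', rfl⟩, h⟩
      obtain ⟨c, hc, rfl⟩ := Ln_mem hf' hu h
      exact (Ln_smul f' c hc).symm
    · rintro rfl
      exact ⟨⟨f, hf, rfl⟩, ⟨u, hu, rfl⟩⟩

theorem fixline (h3 : Module.finrank (ZMod 11) E = 3) (h2 : Module.finrank (ZMod 11) U = 2)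
    (S : Subgroup ((E ⊗[ZMod 11] U) ≃ₗ[ZMod 11] (E ⊗[ZMod 11] U))) (hS : IsPGroup 2 S)
    (hSG : ∀ s ∈ S, ∃ a b, s = Th (a, b)) :
    ∃ f : E, f ≠ 0 ∧ ∀ a b, Th (a, b) ∈ S → ∃ c : ZMod 11, a f = c • f := by
  have : Fact (Nat.Prime 2) := ⟨by norm_num⟩
  have := finW (V := E ⊗[ZMod 11] U)
  have : Nontrivial U := (Module.finrank_pos_iff (R := ZMod 11)).1 (by omega)
  obtain ⟨u, hu⟩ := exists_ne (0 : U)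
  have him : ∀ (a : E ≃ₗ[ZMod 11] E) (b : U ≃ₗ[ZMod 11] U) (f : E), Th (a, b) • (Ln (U := U) f) = Ln (a f) := by
    intro a b f
    change (Th (a, b)) '' (Ln f) = _
    ext y
    constructor
    · rintro ⟨_, ⟨u, hu, rfl⟩, rfl⟩
      refine ⟨b u, ?_, rfl⟩
      change b u ≠ 0
      rwa [Ne, map_eq_zero_iff _ b.injective]
    · rintro ⟨u, hu, rfl⟩
      refine ⟨_, ⟨b.symm u, ?_, rfl⟩, ?_⟩
      · change b.symm u ≠ 0
        rwa [Ne, map_eq_zero_iff _ b.symm.injective]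
      · change Th (a, b) (f ⊗ₜ b.symm u) = a f ⊗ₜ u
        rw [Th_tmul, b.apply_symm_apply]
  obtain ⟨_, ⟨f, hf, rfl⟩, h⟩ := Ga.fixed 2 S hS (Ln (U := U) '' {f : E | f ≠ 0}) (by
    rintro s hs _ ⟨f, hf, rfl⟩
    obtain ⟨a, b, rfl⟩ := hSG s hs
    rw [him]
    refine ⟨a f, ?_, rfl⟩
    change a f ≠ 0
    rwa [Ne, map_eq_zero_iff _ a.injective]) (by rw [Ln_count h3 h2]; norm_num)
  refine ⟨f, hf, fun a b hab => ?_⟩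
  have h5 := h _ hab
  rw [him] at h5
  have h6 : a f ⊗ₜ[ZMod 11] u ∈ Ln (U := U) f := h5 ▸ ⟨u, hu, rfl⟩
  obtain ⟨c, -, hc⟩ := Ln_mem hf hu h6
  exact ⟨c, hc⟩

theorem allscalar (h3 : Module.finrank (ZMod 11) E = 3) (h2 : Module.finrank (ZMod 11) U = 2)
    (S : Subgroup ((E ⊗[ZMod 11] U) ≃ₗ[ZMod 11] (E ⊗[ZMod 11] U))) (hS : IsPGroup 2 S)
    (hSG : ∀ s ∈ S, ∃ a b, s = Th (a, b)) (g : E ≃ₗ[ZMod 11] E) (hg : g ^ 7 = 1)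
    (hfix : ∀ f, g f = f → f = 0)
    (hgS : ∀ s ∈ S, (Th (g, (1 : U ≃ₗ[ZMod 11] U)))⁻¹ * s * Th (g, (1 : U ≃ₗ[ZMod 11] U)) ∈ S) :
    ∀ s ∈ S, ∃ b, s = Th ((1 : E ≃ₗ[ZMod 11] E), b) := by
  obtain ⟨f, hf, hfS⟩ := fixline h3 h2 S hS hSG
  intro s hs
  obtain ⟨a, b, rfl⟩ := hSG s hs
  have hconj : ∀ i : ℕ, Th ((g^i)⁻¹ * a * g^i, b) ∈ S := by
    intro i
    induction i with
    | zero => simpa using hs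
    | succ i ih =>
      have := hgS _ ih
      rw [← map_inv, ← map_mul, ← map_mul] at this
      convert this using 2
      simp only [Prod.mk_mul_mk, Prod.inv_mk, inv_one, one_mul, mul_one]
      congr 1
  obtain ⟨μ, hμ⟩ := scalar h3 g a hg hfix f hf (by
    intro i
    obtain ⟨c, hc⟩ := hfS _ _ (hconj i)
    refine ⟨c, ?_⟩
    have := congrArg (g^i) hc
    rw [map_smul] at this
    rw [← this]
    change _ = (g^i) ((g^i).symm (a ((g^i) f)))
    rw [LinearEquiv.apply_symm_apply])
  have hμ0 : μ ≠ 0 := by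
    rintro rfl
    have := hμ f
    rw [zero_smul, map_eq_zero_iff _ a.injective] at this
    exact hf this
  obtain ⟨a', b', e, e1, -⟩ := scale a b μ hμ0
  refine ⟨b', ?_⟩
  rw [← e]
  congr 2
  ext x
  rw [e1, hμ, smul_smul, inv_mul_cancel₀ hμ0, one_smul]; rfl

theorem final (h3 : Module.finrank (ZMod 11) E = 3) (h2 : Module.finrank (ZMod 11) U = 2)
    (S : Subgroup ((E ⊗[ZMod 11] U) ≃ₗ[ZMod 11] (E ⊗[ZMod 11] U)))
    (hS1 : ∀ s ∈ S, ∃ b, s = Th ((1 : E ≃ₗ[ZMod 11] E), b)) (h16 : 16 ∣ Nat.card S)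
    (h8 : ∀ x : E ⊗[ZMod 11] U, x ≠ 0 → 8 ∣ (stabilizer ((E ⊗[ZMod 11] U) ≃ₗ[ZMod 11] (E ⊗[ZMod 11] U)) x).relIndex S)
    (B : Set (E ⊗[ZMod 11] U)) (hB0 : 0 ∉ B) (hBR : ∀ x ∈ B, x ∉ R1 (ZMod 11) E U) (hBne : B.Nonempty)
    (part : ∀ x ∈ B, ∃ x' ∈ B, x' - x ∈ R1 (ZMod 11) E U ∧ ∀ y ∈ B, y - x ∈ R1 (ZMod 11) E U → y = x')
    (hSB : ∀ s ∈ S, ∀ x ∈ B, s x ∈ B) : False := by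
  have := finW (V := E ⊗[ZMod 11] U)
  have : Nontrivial E := (Module.finrank_pos_iff (R := ZMod 11)).1 (by omega)
  obtain ⟨f, hf⟩ := exists_ne (0 : E)
  have hSL : ∀ s ∈ S, ∀ x ∈ Ln (U := U) f, s • x ∈ Ln (U := U) f := by
    rintro s hs _ ⟨u, hu, rfl⟩
    obtain ⟨b, rfl⟩ := hS1 s hs
    refine ⟨b u, ?_, rfl⟩
    change b u ≠ 0
    rwa [Ne, map_eq_zero_iff _ b.injective]
  -- a nontrivial element with a fixed vector
  obtain ⟨t, htS, ht1, u, hu, htu⟩ : ∃ t ∈ S, t ≠ 1 ∧ ∃ u : U, u ≠ 0 ∧ t (f ⊗ₜ u) = f ⊗ₜ u := by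
    by_contra hcon
    push Not at hcon
    have := Ga.dvd_ncard S (Ln (U := U) f) hSL 16 (by
      rintro _ ⟨u, hu, rfl⟩
      have hinf : stabilizer ((E ⊗[ZMod 11] U) ≃ₗ[ZMod 11] (E ⊗[ZMod 11] U)) (f ⊗ₜ[ZMod 11] u) ⊓ S = ⊥ := by
        rw [Subgroup.eq_bot_iff_forall]
        rintro s ⟨hs, hsS⟩
        by_contra h1
        exact hcon s hsS h1 u hu hs
      change 16 ∣ (stabilizer ((E ⊗[ZMod 11] U) ≃ₗ[ZMod 11] (E ⊗[ZMod 11] U)) (f ⊗ₜ[ZMod 11] u)).relIndex S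
      rw [← Subgroup.inf_relIndex_right, hinf, Subgroup.relIndex_bot_left]
      exact h16)
    rw [Ln_card h2 f hf] at this
    norm_num at this
  have hbfix : ∀ (b : U ≃ₗ[ZMod 11] U) (w : U), Th ((1 : E ≃ₗ[ZMod 11] E), b) (f ⊗ₜ w) = f ⊗ₜ w → b w = w := by
    intro b w h
    by_contra h0
    have h2 : f ⊗ₜ[ZMod 11] (b w - w) = 0 := by rw [TensorProduct.tmul_sub, sub_eq_zero]; exact h
    exact tmul_ne_zero hf (sub_ne_zero.2 h0) h2
  have hext : ∀ (b : U ≃ₗ[ZMod 11] U) (β : Module.Basis (Fin 2) (ZMod 11) U), b (β 0) = β 0 → b (β 1) = β 1 → b = 1 := by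
    intro b β e0 e1
    apply LinearEquiv.toLinearMap_injective
    apply β.ext
    intro i
    fin_cases i
    · exact e0
    · exact e1
  have claim1 : ∀ t ∈ S, t ≠ 1 → ∀ u : U, u ≠ 0 → t (f ⊗ₜ u) = f ⊗ₜ u → ∀ x ∈ B, t x - x ∈ R1 (ZMod 11) E U := by
    intro t ht ht1 u hu htu x hx
    obtain ⟨b, rfl⟩ := hS1 t ht
    obtain ⟨β, rfl⟩ := ext_basis h2 u hu
    have e0 := hbfix b _ htu
    have e1 : b (β 1) ≠ β 1 := by
      intro e1
      apply ht1
      rw [hext b β e0 e1]; exact map_one Th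
    obtain ⟨a1, a2, ha1, ha2, hind, rfl⟩ := rank2 β x (fun h => hB0 (h ▸ hx)) (hBR x hx)
    rw [map_add, Th_tmul, Th_tmul, e0]
    refine ⟨a2, ha2, b (β 1) - β 1, sub_ne_zero.2 e1, ?_⟩
    rw [TensorProduct.tmul_sub]
    change _ = a1 ⊗ₜ[ZMod 11] (β 0) + a2 ⊗ₜ[ZMod 11] (b (β 1)) - _
    abel
  obtain ⟨x, hx⟩ := hBne
  have hcomm : ∀ s ∈ S, s * t * s⁻¹ = t := by
    intro s hs
    have hc : s * t * s⁻¹ ∈ S := S.mul_mem (S.mul_mem hs htS) (S.inv_mem hs)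
    obtain ⟨bs, hbs⟩ := hS1 s hs
    have hbu : bs u ≠ 0 := by rwa [Ne, map_eq_zero_iff _ bs.injective]
    have hsu : s (f ⊗ₜ u) = f ⊗ₜ bs u := by rw [hbs]; rfl
    have h1 := claim1 _ hc (by
      intro h
      apply ht1
      have h5 : s * t = s * 1 := by
        have := mul_inv_eq_one.1 h
        rw [this, mul_one]
      exact mul_left_cancel h5) (bs u) hbu (by
      rw [← hsu]
      change s (t (s.symm (s (f ⊗ₜ u)))) = _
      rw [LinearEquiv.symm_apply_apply, htu]) x hx
    have h2' := claim1 t htS ht1 u hu htu x hx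
    obtain ⟨x', -, -, hun⟩ := part x hx
    have h5 := (hun _ (hSB _ hc x hx) h1).trans (hun _ (hSB _ htS x hx) h2').symm
    obtain ⟨b1, hb1⟩ := hS1 _ hc
    obtain ⟨b2, hb2⟩ := hS1 _ htS
    rw [hb1, hb2] at h5
    rw [hb1, hb2]
    obtain ⟨β, -⟩ := ext_basis h2 u hu
    obtain ⟨a1, a2, ha1, ha2, hind, hxe⟩ := rank2 β x (fun h => hB0 (h ▸ hx)) (hBR x hx)
    rw [hxe, map_add, map_add, Th_tmul, Th_tmul, Th_tmul, Th_tmul] at h5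
    obtain ⟨k0, k1⟩ := uniq' hind ha2 h5
    congr 2
    apply LinearEquiv.toLinearMap_injective
    apply β.ext
    intro i
    fin_cases i
    · exact k0
    · exact k1
  -- the fixed points of t
  obtain ⟨b, hb⟩ := hS1 t htS
  have hΦ : ({x ∈ Ln (U := U) f | t x = x}) = (fun c : ZMod 11 => f ⊗ₜ[ZMod 11] (c • u)) '' {c | c ≠ 0} := by
    ext y
    constructor
    · rintro ⟨⟨w, hw, rfl⟩, hy⟩
      rw [hb] at hy
      have e := hbfix b w hy
      have e' := hbfix b u (by rw [← hb]; exact htu)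
      obtain ⟨β, hβ⟩ := ext_basis h2 u hu
      have hsum := β.sum_repr w
      rw [Fin.sum_univ_two, hβ] at hsum
      have hr : β.repr w 1 = 0 := by
        by_contra hr
        apply ht1
        rw [hb, hext b β (by rw [hβ, e']) ?_]
        · exact map_one Th
        · rw [← hsum, map_add, map_smul, map_smul, e'] at e
          have := add_left_cancel e
          exact smul_right_injective _ hr this
      rw [hr, zero_smul, add_zero] at hsum
      refine ⟨β.repr w 0, ?_, ?_⟩
      · intro h0
        rw [h0, zero_smul] at hsum
        exact hw hsum.symm
      · change f ⊗ₜ[ZMod 11] (β.repr w 0 • u) = f ⊗ₜ w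
        rw [hsum]
    · rintro ⟨c, hc, rfl⟩
      refine ⟨⟨c • u, smul_ne_zero hc hu, rfl⟩, ?_⟩
      change t (f ⊗ₜ (c • u)) = f ⊗ₜ (c • u)
      rw [TensorProduct.tmul_smul, map_smul, htu]
  have hΦc : ({x ∈ Ln (U := U) f | t x = x}).ncard = 10 := by
    rw [hΦ, Set.ncard_image_of_injective]
    · have : {x : ZMod 11 | x ≠ 0} = {0}ᶜ := by ext; simp
      rw [this, Set.ncard_compl, Nat.card_zmod]; simp
    · intro c d h
      have h' : f ⊗ₜ[ZMod 11] (c • u) = f ⊗ₜ[ZMod 11] (d • u) := h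
      by_contra hne
      have h2 : f ⊗ₜ[ZMod 11] ((c - d) • u) = 0 := by rw [sub_smul, TensorProduct.tmul_sub, sub_eq_zero]; exact h
      exact tmul_ne_zero hf (smul_ne_zero (sub_ne_zero.2 hne) hu) h2
  have := Ga.dvd_ncard S {x ∈ Ln (U := U) f | t x = x} (by
    rintro s hs x ⟨hx, htx⟩
    refine ⟨hSL s hs x hx, ?_⟩
    change t (s x) = s x
    conv_lhs => rw [← hcomm s hs]
    change s (t (s.symm (s x))) = _
    rw [LinearEquiv.symm_apply_apply, htx]) 8 (by
    rintro _ ⟨⟨w, hw, rfl⟩, -⟩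
    exact h8 _ (tmul_ne_zero hf hw))
  rw [hΦc] at this
  norm_num at this
end
end Pc

namespace Pc
open Pointwise
open Tn MulAction
section
set_option linter.unusedSectionVars false
variable [Fact (Nat.Prime 11)] {E U : Type*} [AddCommGroup E] [Module (ZMod 11) E] [Finite E]
  [AddCommGroup U] [Module (ZMod 11) U] [Finite U] [Finite (E ⊗[ZMod 11] U)]
  {G₀ : Subgroup ((E ⊗[ZMod 11] U) ≃ₗ[ZMod 11] (E ⊗[ZMod 11] U))}

theorem partC {𝓑 : Set (Set (E ⊗[ZMod 11] U))} (D : Dsg 𝓑 112 31920 G₀)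
    (h3 : Module.finrank (ZMod 11) E = 3) (h2 : Module.finrank (ZMod 11) U = 2)
    (hR : ∀ u ∈ G₀, ∀ x ∈ R1 (ZMod 11) E U, u x ∈ R1 (ZMod 11) E U) : False := by
  have := finW (V := E ⊗[ZMod 11] U)
  have hUnt : Nontrivial U := (Module.finrank_pos_iff (R := ZMod 11)).1 (by omega)
  obtain ⟨w, hw⟩ := exists_ne (0 : U)
  have hG : ∀ u ∈ G₀, ∃ g h, u = Th (g, h) := fun u hu => form h2 (by omega) u (hR u hu)
  have h49 := not49 h3 h2 hG
  have hnf := fun z hz hz7 x hx => nofix D h49 z hz hz7 x hx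
  have hV : Nat.card (E ⊗[ZMod 11] U) = 11 ^ 6 := by
    rw [Module.natCard_eq_pow_finrank (K := ZMod 11), Module.finrank_tensorProduct, h3, h2, Nat.card_zmod]
  obtain ⟨B, hB𝓑, htr, hidx⟩ := block D hV
  have hBc : B.ncard = 112 := D.hk B hB𝓑
  have hBne : B.Nonempty := by rw [← Set.ncard_pos, hBc]; norm_num
  have part : ∀ x ∈ B, ∃ x' ∈ B, x' - x ∈ R1 (ZMod 11) E U ∧ ∀ y ∈ B, y - x ∈ R1 (ZMod 11) E U → y = x' := by
    obtain ⟨n, hn1, hn2⟩ := D.orbit_count (R1 (ZMod 11) E U) zero_notMem_R1 hR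
    rw [R1c h3 h2] at hn2
    have hn : n = 1 := by omega
    intro x hx
    have h1 := hn1 B hB𝓑 x hx
    rw [hn, Set.ncard_eq_one] at h1
    obtain ⟨x', hx'⟩ := h1
    have hm : x' ∈ {y ∈ B | y - x ∈ R1 (ZMod 11) E U} := by rw [hx']; rfl
    refine ⟨x', hm.1, hm.2, fun y hy hyx => ?_⟩
    have : y ∈ ({x'} : Set (E ⊗[ZMod 11] U)) := by rw [← hx']; exact ⟨hy, hyx⟩
    exact this
  have hB0 : (0 : E ⊗[ZMod 11] U) ∉ B := by
    intro h0
    have : B ⊆ {0} := by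
      intro y hy
      obtain ⟨g, -, hg⟩ := htr 0 h0 y hy
      rw [map_zero] at hg
      exact hg.symm
    have := Set.ncard_le_ncard this
    rw [hBc, Set.ncard_singleton] at this
    omega
  generalize hHd : stabilizer ((E ⊗[ZMod 11] U) ≃ₗ[ZMod 11] (E ⊗[ZMod 11] U)) B ⊓ G₀ = H at htr hidx
  have hHG : H ≤ G₀ := hHd ▸ inf_le_right
  have hHB : ∀ s ∈ H, ∀ x ∈ B, s x ∈ B := by
    intro s hs x hx
    have h1 : s ∈ stabilizer ((E ⊗[ZMod 11] U) ≃ₗ[ZMod 11] (E ⊗[ZMod 11] U)) B := by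
      rw [← hHd] at hs; exact hs.1
    have h2 : s '' B = B := h1
    rw [← h2]; exact ⟨x, hx, rfl⟩
  have h112 : 112 ∣ Nat.card H := by
    obtain ⟨x, hx⟩ := hBne
    have horb : orbit H x = B := by
      ext y
      constructor
      · rintro ⟨g, rfl⟩; exact hHB g g.2 x hx
      · intro hy
        obtain ⟨g, hg, h⟩ := htr x hx y hy
        exact ⟨⟨g, hg⟩, h⟩
    rw [← hBc, ← horb, Ga.ncard_orbit]
    exact Subgroup.relIndex_dvd_card _ _
  have hH49 : ¬ 49 ∣ Nat.card H := fun h => h49 (h.trans (Subgroup.card_dvd_of_le hHG))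
  have : Fact (Nat.Prime 7) := ⟨by norm_num⟩
  have : Fact (Nat.Prime 3) := ⟨by norm_num⟩
  have : Fact (Nat.Prime 2) := ⟨by norm_num⟩
  have hBR : ∀ x ∈ B, x ∉ R1 (ZMod 11) E U := by
    rintro _ hx ⟨f, hf, u, hu, rfl⟩
    obtain ⟨z, hz⟩ := exists_prime_orderOf_dvd_card' 7 ((by norm_num : 7 ∣ 112).trans h112)
    have hz' : orderOf (z : (E ⊗[ZMod 11] U) ≃ₗ[ZMod 11] (E ⊗[ZMod 11] U)) = 7 := by rw [Subgroup.orderOf_coe, hz]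
    obtain ⟨g, he, ho, hg7, hgf⟩ := seven h2 hG hnf z (hHG z.2) hz'
    have hyH : Th (g, (1 : U ≃ₗ[ZMod 11] U)) ∈ H := by rw [he]; exact H.pow_mem z.2 _
    have hy1 := hHB _ hyH _ hx
    have hy2 := hHB _ hyH _ hy1
    obtain ⟨x', -, -, hun⟩ := part _ hx
    have hne1 : g f - f ≠ 0 := fun h => hf (hgf f (sub_eq_zero.1 h))
    have k1 := hun _ hy1 ⟨g f - f, hne1, u, hu, TensorProduct.sub_tmul _ _ _⟩
    have hne2 : g (g f) - f ≠ 0 := by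
      intro h
      have hgg : g (g f) = f := sub_eq_zero.1 h
      apply hf
      apply hgf
      have h7 := LinearEquiv.congr_fun hg7 f
      have h7' : g (g (g (g (g (g (g f)))))) = f := h7
      rwa [hgg, hgg, hgg] at h7'
    have k2 := hun _ hy2 ⟨g (g f) - f, hne2, u, hu, TensorProduct.sub_tmul _ _ _⟩
    have k3 := k1.trans k2.symm
    have k4 := (LinearEquiv.injective _) k3
    exact tmul_ne_zero hf hu (hnf _ (hHG hyH) ho _ k4.symm)
  have hH3 : ¬ 3 ∣ Nat.card H := by
    intro h
    obtain ⟨z, hz⟩ := exists_prime_orderOf_dvd_card' 3 h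
    obtain ⟨g, b, he⟩ := hG z (hHG z.2)
    refine three h3 h2 B hB0 hBR (by rw [hBc]; norm_num) part g b ?_ ?_ ?_
    · rw [← he]; exact hHB z z.2
    · rw [← he]; exact hR z (hHG z.2)
    · rw [← he, Subgroup.orderOf_coe, hz]
  obtain ⟨S, z, hz7, hzS⟩ := Ga.GT H ((by norm_num : 7 ∣ 112).trans h112) hH49 hH3 (by
    intro y n hy h
    have hy' : orderOf (y : (E ⊗[ZMod 11] U) ≃ₗ[ZMod 11] (E ⊗[ZMod 11] U)) = 7 := by rw [Subgroup.orderOf_coe, hy]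
    obtain ⟨g, he, ho, hg7, hgf⟩ := seven h2 hG hnf y (hHG y.2) hy'
    obtain ⟨a, b, hn⟩ := hG n (hHG n.2)
    refine noinv h3 g a hg7 hgf ?_
    have h' : (n : (E ⊗[ZMod 11] U) ≃ₗ[ZMod 11] (E ⊗[ZMod 11] U)) * y * (n : (E ⊗[ZMod 11] U) ≃ₗ[ZMod 11] (E ⊗[ZMod 11] U))⁻¹
        = (y : (E ⊗[ZMod 11] U) ≃ₗ[ZMod 11] (E ⊗[ZMod 11] U))⁻¹ := congrArg Subtype.val h
    have hp := congrArg (fun q => q ^ 13200) h'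
    simp only [_root_.conj_pow, inv_pow] at hp
    rw [← he, hn, ← map_inv, ← map_inv, ← map_mul, ← map_mul, ← mul_inv_eq_one, ← map_inv, ← map_mul] at hp
    have : a * g * a⁻¹ * g⁻¹⁻¹ = 1 := by
      apply Th_inj1 _ _ hw
      simpa using hp
    exact mul_inv_eq_one.1 this)
  let S' := (S : Subgroup H).map H.subtype
  have hS'H : S' ≤ H := by
    rintro _ ⟨s, -, rfl⟩; exact s.2
  have hS'c : Nat.card S' = Nat.card S := (Nat.card_congr ((S : Subgroup H).equivMapOfInjective H.subtype H.subtype_injective).toEquiv).symm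
  have hS'p : IsPGroup 2 S' := S.2.map _
  have hodd : ¬ 2 ∣ S'.relIndex G₀ := by
    rw [← Subgroup.relIndex_mul_relIndex S' H G₀ hS'H hHG, hidx]
    have e : S'.relIndex H = (S : Subgroup H).index := by
      rw [Subgroup.relIndex]
      congr 1
      exact Subgroup.comap_map_eq_self_of_injective H.subtype_injective _
    rw [e]
    intro h
    rcases (Nat.Prime.dvd_mul (by norm_num)).1 h with h | h
    · exact S.not_dvd_index h
    · norm_num at h
  have h16 : 16 ∣ Nat.card S' := by
    have h5 := card_rel S' G₀ (hS'H.trans hHG)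
    have h6 : 16 ∣ Nat.card G₀ := ((by norm_num : 16 ∣ 112).trans h112).trans (Subgroup.card_dvd_of_le hHG)
    rw [← h5] at h6
    refine Nat.Coprime.dvd_of_dvd_mul_right ?_ h6
    rw [show 16 = 2^4 by norm_num]
    exact ((Nat.Prime.coprime_iff_not_dvd (by norm_num)).2 hodd).pow_left 4
  have h8 : ∀ x : E ⊗[ZMod 11] U, x ≠ 0 → 8 ∣ (stabilizer ((E ⊗[ZMod 11] U) ≃ₗ[ZMod 11] (E ⊗[ZMod 11] U)) x).relIndex S' := by
    intro x hx
    apply Ga.dvd_sub S' G₀ (hS'H.trans hHG) 8 x ((by norm_num : 8 ∣ 15960).trans (div_orb D x hx))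
    rw [show 8 = 2^3 by norm_num]
    exact ((Nat.Prime.coprime_iff_not_dvd (by norm_num)).2 hodd).pow_left 3
  have hzi : orderOf (z⁻¹ : H) = 7 := by rw [orderOf_inv, hz7]
  have hzi' : orderOf ((z⁻¹ : H) : (E ⊗[ZMod 11] U) ≃ₗ[ZMod 11] (E ⊗[ZMod 11] U)) = 7 := by rw [Subgroup.orderOf_coe, hzi]
  obtain ⟨g, he, ho, hg7, hgf⟩ := seven h2 hG hnf (z⁻¹ : H) (hHG (z⁻¹ : H).2) hzi'
  have hzn : ∀ n : ℕ, ∀ s ∈ S, z ^ n * s * (z ^ n)⁻¹ ∈ S := by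
    intro n s hs
    induction n with
    | zero => simpa using hs
    | succ n ih =>
      have := hzS _ ih
      convert this using 1
      rw [pow_succ']; group
  refine final h3 h2 S' (allscalar h3 h2 S' hS'p (fun s hs => hG s (hHG (hS'H hs))) g hg7 hgf ?_) h16 h8 B hB0 hBR hBne part
    (fun s hs => hHB s (hS'H hs))
  rintro _ ⟨s, hs, rfl⟩
  refine ⟨_, hzn 13200 s hs, ?_⟩
  rw [he]
  simp
end
end Pc

/-- Let `V = GF(p)^a ⊗ GF(p)^c` with `2 ≤ c ≤ a`, and let `D` be a
nontrivial 2-(p^{ac},k,2) design with point set `V` and even `r`, admitting a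
flag-transitive, point-primitive `G = T ⋊ G₀` where `G₀ ≤ N_{GL(V)}({g ⊗ h})`.  Then
`(p,a,c,k,r)` is one of `(2,2,2,6,6)`, `(3,2,2,6,32)`, `(2,3,2,4,42)`, `(3,3,2,8,208)`. -/
theorem stmt_19 (p a c : ℕ) [Fact p.Prime] (hc : 2 ≤ c) (hca : c ≤ a)
    (𝓑 : Set (Set (TensorProduct (ZMod p) (Fin a → ZMod p) (Fin c → ZMod p))))
    (k r : ℕ)
    (G₀ : Subgroup ((TensorProduct (ZMod p) (Fin a → ZMod p) (Fin c → ZMod p)) ≃ₗ[ZMod p]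
      (TensorProduct (ZMod p) (Fin a → ZMod p) (Fin c → ZMod p))))
    (hk : ∀ B ∈ 𝓑, B.ncard = k)
    (hlam : ∀ x y : TensorProduct (ZMod p) (Fin a → ZMod p) (Fin c → ZMod p), x ≠ y →
      {B ∈ 𝓑 | x ∈ B ∧ y ∈ B}.ncard = 2)
    (hr : ∀ x : TensorProduct (ZMod p) (Fin a → ZMod p) (Fin c → ZMod p),
      {B ∈ 𝓑 | x ∈ B}.ncard = r)
    (hk2 : 2 < k)
    (hkv : k < Nat.card (TensorProduct (ZMod p) (Fin a → ZMod p) (Fin c → ZMod p)))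
    (hreven : Even r)
    (hinv : ∀ B ∈ 𝓑, ∀ g ∈ G₀,
      ∀ v : TensorProduct (ZMod p) (Fin a → ZMod p) (Fin c → ZMod p),
      (fun x => g x + v) '' B ∈ 𝓑)
    (hflag : ∀ B ∈ 𝓑, ∀ C ∈ 𝓑, ∀ x ∈ B, ∀ y ∈ C,
      ∃ g ∈ G₀, ∃ v : TensorProduct (ZMod p) (Fin a → ZMod p) (Fin c → ZMod p),
        (fun z => g z + v) '' B = C ∧ g x + v = y)
    -- point-primitivity: `G₀` acts irreducibly on `V`
    (hprim : ∀ W : Submodule (ZMod p) (TensorProduct (ZMod p) (Fin a → ZMod p) (Fin c → ZMod p)),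
      (∀ g ∈ G₀, ∀ x ∈ W, g x ∈ W) → W = ⊥ ∨ W = ⊤)
    -- `G₀` normalizes the subgroup `{g ⊗ h : g ∈ GL_a(p), h ∈ GL_c(p)}`
    (hnorm : ∀ u ∈ G₀, ∀ (g : (Fin a → ZMod p) ≃ₗ[ZMod p] (Fin a → ZMod p))
        (h : (Fin c → ZMod p) ≃ₗ[ZMod p] (Fin c → ZMod p)),
      ∃ (g' : (Fin a → ZMod p) ≃ₗ[ZMod p] (Fin a → ZMod p))
        (h' : (Fin c → ZMod p) ≃ₗ[ZMod p] (Fin c → ZMod p)),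
        u * (TensorProduct.congr g h) * u⁻¹ = TensorProduct.congr g' h') :
    (p = 2 ∧ a = 2 ∧ c = 2 ∧ k = 6 ∧ r = 6) ∨
    (p = 3 ∧ a = 2 ∧ c = 2 ∧ k = 6 ∧ r = 32) ∨
    (p = 2 ∧ a = 3 ∧ c = 2 ∧ k = 4 ∧ r = 42) ∨
    (p = 3 ∧ a = 3 ∧ c = 2 ∧ k = 8 ∧ r = 208) := by
  have hp : p.Prime := Fact.out
  have hfin : Finite (TensorProduct (ZMod p) (Fin a → ZMod p) (Fin c → ZMod p)) := Module.finite_of_finite (ZMod p)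
  have hne1 : Nonempty (Fin a) := ⟨⟨0, by omega⟩⟩
  have hne2 : Nonempty (Fin c) := ⟨⟨0, by omega⟩⟩
  have D : Dsg 𝓑 k r G₀ := ⟨hk, hlam, hr, hk2, hkv, hinv, hflag⟩
  have hR := Tn.R1_inv G₀ hnorm
  have hV : Nat.card (TensorProduct (ZMod p) (Fin a → ZMod p) (Fin c → ZMod p)) = p ^ (a * c) := by
    rw [Module.natCard_eq_pow_finrank (K := ZMod p), Module.finrank_tensorProduct, Module.finrank_fin_fun,
      Module.finrank_fin_fun, Nat.card_zmod]
  have hN := Tn.card_R1 (F := ZMod p) (E := Fin a → ZMod p) (U := Fin c → ZMod p)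
  rw [Nat.card_zmod, Module.natCard_eq_pow_finrank (K := ZMod p) (V := Fin a → ZMod p),
    Module.natCard_eq_pow_finrank (K := ZMod p) (V := Fin c → ZMod p), Module.finrank_fin_fun,
    Module.finrank_fin_fun, Nat.card_zmod] at hN
  obtain ⟨n, -, hn⟩ := D.orbit_count _ Tn.zero_notMem_R1 hR
  have hrk := D.rk
  have hd := D.dvd_or
  rw [hV] at hrk
  try rw [hV] at hd
  have hmain := Ar.main p a c _ r n k hp hc hca hN hreven hn hrk D.fisher hk2 hd
  have h5 : ¬ (p = 11 ∧ a = 3 ∧ c = 2 ∧ k = 112 ∧ r = 31920) := by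
    rintro ⟨rfl, rfl, rfl, rfl, rfl⟩
    exact Pc.partC D (Module.finrank_fin_fun _) (Module.finrank_fin_fun _) hR
  rcases hmain with h | h | h | h | h
  · exact Or.inl h
  · exact Or.inr (Or.inl h)
  · exact Or.inr (Or.inr (Or.inl h))
  · exact Or.inr (Or.inr (Or.inr h))
  · exact absurd h h5
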